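/- arXiv:2409.06200 — 5 statements merged into one kernel-verified Lean document; each statement's English description precedes it below -/
import Mathlib

section
/- Let 𝒞 be an extension-closed pseudo-variety of finite groups, and let A and B be groups such that A is abelian and residually-𝒞 and B is an infinite 𝒞-hereditarily conjugacy separable group each of whose cyclic subgroups is 𝒞-separable in B. Then for all nontrivial h in the base group ⨁_{x∈B} A and nontrivial b ∈ B, the element hb satisfies the 𝒞-centralizer condition in A ≀ B. -/
open Pointwise

universe u

structure ECPseudoVariety : Type (u + 1) where
  mem : ∀ (G : Type u) [Group G], Prop
  finite : ∀ (G : Type u) [Group G], mem G → Finite G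
  iso_closed : ∀ (G H : Type u) [Group G] [Group H], G ≃* H → mem G → mem H
  subgroup_closed : ∀ (G : Type u) [Group G] (H : Subgroup G), mem G → mem ↥H
  quotient_closed : ∀ (G : Type u) [Group G] (N : Subgroup G) [N.Normal],
    mem G → mem (G ⧸ N)
  prod_closed : ∀ (G H : Type u) [Group G] [Group H], mem G → mem H → mem (G × H)
  extension_closed : ∀ (G : Type u) [Group G] (N : Subgroup G) [N.Normal],
    mem ↥N → mem (G ⧸ N) → mem G

namespace ECPseudoVariety

variable (V : ECPseudoVariety.{u})

def coC (G : Type u) [Group G] : Set (Subgroup G) :=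
  {N | ∃ hN : N.Normal, haveI := hN; V.mem (G ⧸ N)}

def CSeparable {G : Type u} [Group G] (X : Set G) : Prop :=
  ∀ g : G, g ∉ X → ∃ N ∈ V.coC G, (QuotientGroup.mk g : G ⧸ N) ∉ QuotientGroup.mk '' X

def Residually (G : Type u) [Group G] : Prop :=
  ∀ g : G, g ≠ 1 → ∃ N ∈ V.coC G, g ∉ N

def ConjSep (G : Type u) [Group G] : Prop :=
  ∀ g : G, V.CSeparable {x : G | IsConj g x}

def COpen {G : Type u} [Group G] (H : Subgroup G) : Prop :=
  ∃ N ∈ V.coC G, N ≤ H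

def HCS (G : Type u) [Group G] : Prop :=
  V.ConjSep G ∧ ∀ H : Subgroup G, V.COpen H → V.ConjSep ↥H

def CyclicSep (G : Type u) [Group G] : Prop :=
  ∀ g : G, V.CSeparable ((Subgroup.zpowers g : Subgroup G) : Set G)

end ECPseudoVariety

def CCWitness {G : Type u} [Group G] (g : G) (K L : Subgroup G) [L.Normal] : Prop :=
  (Subgroup.centralizer {(QuotientGroup.mk g : G ⧸ L)} : Set (G ⧸ L)) ⊆
    QuotientGroup.mk '' ((Subgroup.centralizer {g} : Set G) * (K : Set G))

namespace ECPseudoVariety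

variable (V : ECPseudoVariety.{u})

def SatisfiesCCAt {G : Type u} [Group G] (g : G) : Prop :=
  ∀ K ∈ V.coC G, ∃ L ∈ V.coC G, L ≤ K ∧ ∃ hL : L.Normal, haveI := hL; CCWitness g K L

def SatisfiesCC (G : Type u) [Group G] : Prop :=
  ∀ g : G, V.SatisfiesCCAt g

end ECPseudoVariety

/-- `G` is conjugacy separable. -/
def IsConjSeparable (G : Type u) [Group G] : Prop :=
  ∀ x y : G, ¬ IsConj x y → ∃ N : Subgroup G, ∃ hN : N.Normal, N.FiniteIndex ∧
    (haveI := hN; ¬ IsConj (QuotientGroup.mk x : G ⧸ N) (QuotientGroup.mk y))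

/-- `G` is hereditarily conjugacy separable: every finite-index subgroup is
conjugacy separable. -/
def IsHereditarilyConjSeparable (G : Type u) [Group G] : Prop :=
  ∀ H : Subgroup G, H.FiniteIndex → IsConjSeparable H

/-- `G` is residually finite. -/
def IsResiduallyFinite (G : Type u) [Group G] : Prop :=
  ∀ g : G, g ≠ 1 → ∃ N : Subgroup G, N.Normal ∧ N.FiniteIndex ∧ g ∉ N

/-- Normal subgroups with finite `p`-group quotient. -/
def pCoC (p : ℕ) (G : Type u) [Group G] : Set (Subgroup G) :=
  {N | ∃ hN : N.Normal, Finite (G ⧸ N) ∧ (haveI := hN; IsPGroup p (G ⧸ N))}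

/-- `G` is `p`-conjugacy separable. -/
def pConjSep (p : ℕ) (G : Type u) [Group G] : Prop :=
  ∀ x y : G, ¬ IsConj x y → ∃ N ∈ pCoC p G, ∃ hN : N.Normal,
    haveI := hN; ¬ IsConj (QuotientGroup.mk x : G ⧸ N) (QuotientGroup.mk y)

/-- A subgroup is `p`-open if it contains a normal subgroup with finite
`p`-group quotient. -/
def pOpen (p : ℕ) {G : Type u} [Group G] (H : Subgroup G) : Prop :=
  ∃ N ∈ pCoC p G, N ≤ H

/-- `G` is `p`-hereditarily conjugacy separable. -/
def pHCS (p : ℕ) (G : Type u) [Group G] : Prop :=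
  pConjSep p G ∧ ∀ H : Subgroup G, pOpen p H → pConjSep p H

/-- The base group of the restricted wreath product: finitely supported functions `B → A`. -/
def WreathBase (A B : Type u) [Group A] : Subgroup (B → A) where
  carrier := {f | (Function.mulSupport f).Finite}
  one_mem' := by simp
  mul_mem' := fun hf hg =>
    Set.Finite.subset (Set.Finite.union hf hg) (Function.mulSupport_mul _ _)
  inv_mem' := fun hf => Set.Finite.subset hf fun x hx => by
    simp only [Function.mem_mulSupport] at hx ⊢
    simpa using hx

/-- Shift automorphism of the base group: `(c • f) x = f (c⁻¹ * x)`. -/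
def wreathShift (A B : Type u) [Group A] [Group B] (c : B) :
    WreathBase A B ≃* WreathBase A B where
  toFun f := ⟨fun x => (f : B → A) (c⁻¹ * x), by
    have hsub : (Function.mulSupport fun x => (f : B → A) (c⁻¹ * x)) ⊆
        (fun x : B => c * x) '' Function.mulSupport (f : B → A) := by
      intro x hx
      exact ⟨c⁻¹ * x, hx, by simp⟩
    exact (f.2.image _).subset hsub⟩
  invFun f := ⟨fun x => (f : B → A) (c * x), by
    have hsub : (Function.mulSupport fun x => (f : B → A) (c * x)) ⊆
        (fun x : B => c⁻¹ * x) '' Function.mulSupport (f : B → A) := by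
      intro x hx
      exact ⟨c * x, hx, by simp⟩
    exact (f.2.image _).subset hsub⟩
  left_inv f := Subtype.ext (funext fun x => by simp)
  right_inv f := Subtype.ext (funext fun x => by simp)
  map_mul' f g := rfl

/-- The action of `B` on the base group of the wreath product. -/
def wreathAction (A B : Type u) [Group A] [Group B] : B →* MulAut (WreathBase A B) where
  toFun := wreathShift A B
  map_one' := by
    apply MulEquiv.ext
    intro f
    apply Subtype.ext
    funext x
    show (f : B → A) ((1 : B)⁻¹ * x) = (f : B → A) x
    simp
  map_mul' c d := by
    apply MulEquiv.ext
    intro f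
    apply Subtype.ext
    funext x
    show (f : B → A) ((c * d)⁻¹ * x) = (f : B → A) (d⁻¹ * (c⁻¹ * x))
    rw [mul_inv_rev, mul_assoc]

/-- The restricted wreath product `A ≀ B`. -/
abbrev RWreath (A B : Type u) [Group A] [Group B] : Type u :=
  SemidirectProduct (WreathBase A B) B (wreathAction A B)
def rcoset {B : Type u} [Group B] (b x : B) : Set B :=
  {y : B | y * x⁻¹ ∈ Subgroup.zpowers b}

lemma rcoset_mul_left {B : Type u} [Group B] {b c : B}
    (hc : c ∈ Subgroup.centralizer {b}) (y : B) :
    rcoset b (c * y) = (c * ·) '' rcoset b y := by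
  have hcomm : b * c = c * b := Subgroup.mem_centralizer_iff.mp hc b rfl
  have hC : Commute b c := hcomm
  ext z
  simp only [rcoset, Set.mem_setOf_eq, Set.mem_image]
  constructor
  · intro hz
    refine ⟨c⁻¹ * z, ?_, by group⟩
    obtain ⟨k, hk⟩ := Subgroup.mem_zpowers_iff.mp hz
    refine Subgroup.mem_zpowers_iff.mpr ⟨k, ?_⟩
    have hcc : b ^ k * c = c * b ^ k := (hC.zpow_left k).eq
    have hk' : z * y⁻¹ = b ^ k * c := by
      rw [hk]; group
    calc b ^ k = c⁻¹ * (c * b ^ k) := by group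
      _ = c⁻¹ * (b ^ k * c) := by rw [hcc]
      _ = c⁻¹ * (z * y⁻¹) := by rw [hk']
      _ = c⁻¹ * z * y⁻¹ := by group
  · rintro ⟨w, hw, rfl⟩
    obtain ⟨k, hk⟩ := Subgroup.mem_zpowers_iff.mp hw
    refine Subgroup.mem_zpowers_iff.mpr ⟨k, ?_⟩
    have hcc : b ^ k * c = c * b ^ k := (hC.zpow_left k).eq
    calc b ^ k = c * b ^ k * c⁻¹ := by rw [← hcc]; group
      _ = c * (w * y⁻¹) * c⁻¹ := by rw [hk]
      _ = c * w * (c * y)⁻¹ := by group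

/-- An element `fb` of `A ≀ B` is reduced if distinct elements of `supp f` lie in
distinct right cosets of `⟨b⟩`. -/
def IsReducedPair {A B : Type u} [Group A] [Group B] (f : WreathBase A B) (b : B) : Prop :=
  ∀ s ∈ Function.mulSupport (f : B → A), ∀ t ∈ Function.mulSupport (f : B → A),
    t * s⁻¹ ∈ Subgroup.zpowers b → s = t

/-- The set `C_B(f,b) = C⁺_B(f,b) ∩ C_B(b)`. -/
def CBset {A B : Type u} [Group A] [Group B] (f : WreathBase A B) (b : B) : Set B :=
  {c | c ∈ Subgroup.centralizer {b} ∧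
    ∀ a : A, a ≠ 1 → a ∈ Set.range (f : B → A) →
      (fun s : B => rcoset b (c * s)) '' ((f : B → A) ⁻¹' {a}) =
        rcoset b '' ((f : B → A) ⁻¹' {a})}

/-- `C_B(f,b)` as a subgroup of `B`. -/
def CBsubgroup {A B : Type u} [Group A] [Group B] (f : WreathBase A B) (b : B) :
    Subgroup B where
  carrier := CBset f b
  one_mem' := by
    refine ⟨Subgroup.one_mem _, ?_⟩
    intro a _ _
    simp
  mul_mem' := by
    rintro c c' ⟨hc1, hc2⟩ ⟨hc'1, hc'2⟩
    refine ⟨Subgroup.mul_mem _ hc1 hc'1, ?_⟩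
    intro a ha har
    calc (fun s : B => rcoset b (c * c' * s)) '' ((f : B → A) ⁻¹' {a})
        = (fun s : B => (c * ·) '' rcoset b (c' * s)) '' ((f : B → A) ⁻¹' {a}) := by
          have he : (fun s : B => rcoset b (c * c' * s)) =
              fun s : B => (c * ·) '' rcoset b (c' * s) := by
            funext s; rw [mul_assoc, rcoset_mul_left hc1]
          rw [he]
      _ = (fun X : Set B => (c * ·) '' X) ''
            ((fun s : B => rcoset b (c' * s)) '' ((f : B → A) ⁻¹' {a})) := by
          rw [Set.image_image]
      _ = (fun X : Set B => (c * ·) '' X) '' (rcoset b '' ((f : B → A) ⁻¹' {a})) := by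
          rw [hc'2 a ha har]
      _ = (fun s : B => (c * ·) '' rcoset b s) '' ((f : B → A) ⁻¹' {a}) := by
          rw [Set.image_image]
      _ = (fun s : B => rcoset b (c * s)) '' ((f : B → A) ⁻¹' {a}) := by
          have he : (fun s : B => (c * ·) '' rcoset b s) =
              fun s : B => rcoset b (c * s) := by
            funext s; rw [rcoset_mul_left hc1]
          rw [he]
      _ = rcoset b '' ((f : B → A) ⁻¹' {a}) := hc2 a ha har
  inv_mem' := by
    rintro c ⟨hc1, hc2⟩
    have hinv : c⁻¹ ∈ Subgroup.centralizer {b} := Subgroup.inv_mem _ hc1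
    refine ⟨hinv, ?_⟩
    intro a ha har
    calc (fun s : B => rcoset b (c⁻¹ * s)) '' ((f : B → A) ⁻¹' {a})
        = (fun s : B => (c⁻¹ * ·) '' rcoset b s) '' ((f : B → A) ⁻¹' {a}) := by
          have he : (fun s : B => rcoset b (c⁻¹ * s)) =
              fun s : B => (c⁻¹ * ·) '' rcoset b s := by
            funext s; rw [rcoset_mul_left hinv]
          rw [he]
      _ = (fun X : Set B => (c⁻¹ * ·) '' X) '' (rcoset b '' ((f : B → A) ⁻¹' {a})) := by
          rw [Set.image_image]
      _ = (fun X : Set B => (c⁻¹ * ·) '' X) ''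
            ((fun s : B => rcoset b (c * s)) '' ((f : B → A) ⁻¹' {a})) := by
          rw [hc2 a ha har]
      _ = (fun s : B => (c⁻¹ * ·) '' rcoset b (c * s)) '' ((f : B → A) ⁻¹' {a}) := by
          rw [Set.image_image]
      _ = rcoset b '' ((f : B → A) ⁻¹' {a}) := by
          have he : (fun s : B => (c⁻¹ * ·) '' rcoset b (c * s)) =
              fun s : B => rcoset b s := by
            funext s; rw [← rcoset_mul_left hinv, inv_mul_cancel_left]
          rw [he]

/-- The permutation group condition set `Σ(f,b)`. -/
def SigmaSet {A B : Type u} [Group A] [Group B] (f : WreathBase A B) (b : B) :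
    Set (Equiv.Perm ↥(Function.mulSupport (f : B → A))) :=
  {σ | ∀ a : A, a ≠ 1 →
    (fun s : ↥(Function.mulSupport (f : B → A)) => rcoset b ↑(σ s)) ''
        {s : ↥(Function.mulSupport (f : B → A)) | (f : B → A) ↑s = a} =
      (fun s : ↥(Function.mulSupport (f : B → A)) => rcoset b ↑s) ''
        {s : ↥(Function.mulSupport (f : B → A)) | (f : B → A) ↑s = a}}

namespace CCproof

section coC
variable (V : ECPseudoVariety.{u})

lemma mem_of_inj {G H : Type u} [Group G] [Group H] (f : G →* H)
    (hf : Function.Injective f) (hH : V.mem H) : V.mem G :=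
  V.iso_closed _ _ (MonoidHom.ofInjective hf).symm (V.subgroup_closed H f.range hH)

lemma mem_of_surj {G H : Type u} [Group G] [Group H] (f : G →* H)
    (hf : Function.Surjective f) (hG : V.mem G) : V.mem H :=
  V.iso_closed _ _ (QuotientGroup.quotientKerEquivOfSurjective f hf)
    (V.quotient_closed G f.ker hG)

lemma ker_coC {G H : Type u} [Group G] [Group H] (f : G →* H) (hH : V.mem H) :
    f.ker ∈ V.coC G :=
  ⟨inferInstance, mem_of_inj V (QuotientGroup.kerLift f) (QuotientGroup.kerLift_injective f) hH⟩

lemma comap_coC {G H : Type u} [Group G] [Group H] (f : G →* H) {N : Subgroup H}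
    (hN : N ∈ V.coC H) : N.comap f ∈ V.coC G := by
  obtain ⟨hn, hm⟩ := hN
  have h := ker_coC V ((QuotientGroup.mk' N).comp f) hm
  have e : ((QuotientGroup.mk' N).comp f).ker = N.comap f := by
    ext x; simp [MonoidHom.mem_ker]
  rwa [e] at h

lemma up_coC {G : Type u} [Group G] {N N' : Subgroup G} (hN : N ∈ V.coC G)
    (hle : N ≤ N') (hn' : N'.Normal) : N' ∈ V.coC G := by
  obtain ⟨hn, hm⟩ := hN
  refine ⟨hn', ?_⟩
  refine mem_of_surj V (QuotientGroup.map N N' (MonoidHom.id G) hle) ?_ hm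
  intro q
  obtain ⟨x, rfl⟩ := QuotientGroup.mk_surjective q
  exact ⟨QuotientGroup.mk x, rfl⟩

lemma inf_coC {G : Type u} [Group G] {N N' : Subgroup G} (hN : N ∈ V.coC G)
    (hN' : N' ∈ V.coC G) : N ⊓ N' ∈ V.coC G := by
  obtain ⟨hn, hm⟩ := hN
  obtain ⟨hn', hm'⟩ := hN'
  have h := ker_coC V ((QuotientGroup.mk' N).prod (QuotientGroup.mk' N'))
    (V.prod_closed _ _ hm hm')
  have e : ((QuotientGroup.mk' N).prod (QuotientGroup.mk' N')).ker = N ⊓ N' := by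
    ext x; simp [MonoidHom.mem_ker]
  rwa [e] at h

lemma exists_fin {G : Type u} [Group G] {ι : Type*} (S : Set ι) (hS : S.Finite)
    (Q : ι → Subgroup G → Prop) (anti : ∀ i N N', N' ≤ N → Q i N → Q i N')
    (hex : ∀ i ∈ S, ∃ N ∈ V.coC G, Q i N) (N0 : Subgroup G) (h0 : N0 ∈ V.coC G) :
    ∃ N ∈ V.coC G, N ≤ N0 ∧ ∀ i ∈ S, Q i N := by
  induction S, hS using Set.Finite.induction_on with
  | empty => exact ⟨N0, h0, le_rfl, by simp⟩
  | @insert a S _ _ ih =>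
    obtain ⟨N, hN, hle, hq⟩ := ih (fun i hi => hex i (Set.mem_insert_of_mem _ hi))
    obtain ⟨N', hN', hq'⟩ := hex a (Set.mem_insert _ _)
    refine ⟨N ⊓ N', inf_coC V hN hN', inf_le_left.trans hle, ?_⟩
    rintro i (rfl | hi)
    · exact anti _ _ _ inf_le_right hq'
    · exact anti _ _ _ inf_le_left (hq i hi)

lemma ext_coC {G W : Type u} [Group G] [Group W] (i : W →* G) (L P : Subgroup G)
    (hL : L.Normal) (hP : P ∈ V.coC G) (hLP : L ≤ P) (hiP : ∀ w, i w ∈ P)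
    (hsurj : ∀ p ∈ P, ∃ w, (i w)⁻¹ * p ∈ L) (hc : L.comap i ∈ V.coC W) : L ∈ V.coC G := by
  obtain ⟨hn, hm⟩ := hP
  obtain ⟨hn', hm'⟩ := hc
  refine ⟨hL, V.extension_closed _ (P.map (QuotientGroup.mk' L)) ?_ ?_⟩
  · let j : W →* ↥(P.map (QuotientGroup.mk' L)) :=
      ((QuotientGroup.mk' L).comp i).codRestrict _ (fun w => ⟨i w, hiP w, rfl⟩)
    have hj : Function.Surjective j := by
      rintro ⟨_, p, hp, rfl⟩
      obtain ⟨w, hw⟩ := hsurj p hp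
      exact ⟨w, Subtype.ext (QuotientGroup.eq.mpr hw)⟩
    have hk : L.comap i ≤ j.ker := by
      intro w hw
      rw [MonoidHom.mem_ker]
      exact Subtype.ext ((QuotientGroup.eq_one_iff _).mpr hw)
    refine mem_of_surj V (QuotientGroup.lift (L.comap i) j (fun x hx => hk hx)) ?_ hm'
    intro y
    obtain ⟨w, rfl⟩ := hj y
    exact ⟨QuotientGroup.mk w, rfl⟩
  · exact V.iso_closed _ _ (QuotientGroup.quotientQuotientEquivQuotient L P hLP).symm hm

/-- finite-index core argument -/
lemma core_coC {G : Type u} [Group G] {N H : Subgroup G} (hN : N ∈ V.coC G) (hNH : N ≤ H)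
    {L : Subgroup H} (hL : L ∈ V.coC H) :
    ∃ L' ∈ V.coC G, L' ≤ N ∧ L' ≤ L.map H.subtype := by
  have hN0 := hN
  obtain ⟨hn, hm⟩ := hN
  have hLn := hL.1
  have hfin := V.finite _ hm
  let C := (N ⊓ L.map H.subtype).normalCore
  have hCle : C ≤ N ⊓ L.map H.subtype := Subgroup.normalCore_le _
  refine ⟨C, ?_, hCle.trans inf_le_left, hCle.trans inf_le_right⟩
  refine ext_coC V N.subtype C N inferInstance hN0 (hCle.trans inf_le_left) (fun w => w.2)
    (fun p hp => ⟨⟨p, hp⟩, by simp [C.one_mem]⟩) ?_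
  let cj : G → (N →* H) := fun g =>
    (Subgroup.inclusion hNH).comp ((MulAut.conjNormal g : N ≃* N).toMonoidHom)
  obtain ⟨M, hM, -, hMq⟩ := exists_fin V (G := N) (Set.univ : Set (G ⧸ N)) Set.finite_univ
    (fun q M => M ≤ L.comap (cj q.out)) (fun i N N' h h' => h.trans h')
    (fun q _ => ⟨_, comap_coC V _ hL, le_rfl⟩) (L.comap (cj 1)) (comap_coC V _ hL)
  refine up_coC V hM ?_ inferInstance
  intro x hx
  show (x : G) ∈ C
  intro g
  refine ⟨hn.conj_mem _ x.2 g, ?_⟩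
  have h1 := hMq (QuotientGroup.mk g) trivial hx
  set o := (QuotientGroup.mk g : G ⧸ N).out with ho
  have h2 : g⁻¹ * o ∈ N := by
    rw [← QuotientGroup.eq]; exact (Quotient.out_eq' _).symm
  have h3 : g * o⁻¹ ∈ N := by
    have := hn.conj_mem _ (N.inv_mem h2) g
    simpa [mul_assoc] using this
  have h4 : (⟨g * o⁻¹, hNH h3⟩ : H) * (cj o x) * (⟨g * o⁻¹, hNH h3⟩ : H)⁻¹ ∈ L :=
    hLn.conj_mem _ h1 _
  refine ⟨_, h4, ?_⟩
  simp [cj, mul_assoc]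

/-- HCS implies the centralizer condition. -/
lemma CC_of_HCS {B : Type u} [Group B] (hB : V.HCS B) (b : B) (N : Subgroup B)
    (hN : N ∈ V.coC B) : ∃ N' ∈ V.coC B, N' ≤ N ∧
      ∀ c : B, c * b * (b * c)⁻¹ ∈ N' → ∃ c1, c1 * b = b * c1 ∧ c1⁻¹ * c ∈ N := by
  have hn := hN.1
  have hfin := V.finite _ hN.2
  let H : Subgroup B := N ⊔ Subgroup.zpowers b
  have hNH : N ≤ H := le_sup_left
  have hbH : b ∈ H := (le_sup_right : Subgroup.zpowers b ≤ H) (Subgroup.mem_zpowers b)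
  have hCS := hB.2 H ⟨N, hN, hNH⟩
  -- condition for a coset
  obtain ⟨N', hN', hle, hq⟩ := exists_fin V (Set.univ : Set (B ⧸ N)) Set.finite_univ
    (fun q M => (∃ c1, c1 * b = b * c1 ∧ c1⁻¹ * q.out ∈ N) ∨
      ∀ k ∈ N, (k * b * k⁻¹)⁻¹ * (q.out⁻¹ * b * q.out) ∉ M)
    (fun i M M' h h' => h'.imp id (fun h'' k hk hk' => h'' k hk (h hk')))
    (fun q _ => by
      by_cases hc : ∃ c1, c1 * b = b * c1 ∧ c1⁻¹ * q.out ∈ N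
      · exact ⟨N, hN, Or.inl hc⟩
      set z := q.out
      by_cases hz : z⁻¹ * b * z ∈ H
      · have hnot : (⟨z⁻¹ * b * z, hz⟩ : H) ∉ {x : H | IsConj ⟨b, hbH⟩ x} := by
          intro hconj
          obtain ⟨c, hcc⟩ := isConj_iff.mp hconj
          obtain ⟨k, hk, y, hy, hky⟩ := Subgroup.mem_sup_of_normal_left.mp c.2
          obtain ⟨i, rfl⟩ := Subgroup.mem_zpowers_iff.mp hy
          apply hc
          have e : (c : B) * b * (c : B)⁻¹ = z⁻¹ * b * z := congrArg Subtype.val hcc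
          have e2 : k * b * k⁻¹ = z⁻¹ * b * z := by
            rw [← e, ← hky]; group
          refine ⟨z * k, ?_, ?_⟩
          · calc z * k * b = z * (k * b * k⁻¹) * k := by group
              _ = b * (z * k) := by rw [e2]; group
          · simpa [mul_assoc] using N.inv_mem hk
        obtain ⟨L, hL, hLs⟩ := hCS ⟨b, hbH⟩ _ hnot
        obtain ⟨L', hL', hL'N, hL'L⟩ := core_coC V hN hNH hL
        refine ⟨L', hL', Or.inr ?_⟩
        intro k hk hmem
        apply hLs
        obtain ⟨l, hl, hle⟩ := hL'L hmem
        refine ⟨⟨k, hNH hk⟩ * ⟨b, hbH⟩ * ⟨k, hNH hk⟩⁻¹, isConj_iff.mpr ⟨_, rfl⟩, ?_⟩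
        rw [QuotientGroup.eq]
        have el : l = (⟨k, hNH hk⟩ * ⟨b, hbH⟩ * ⟨k, hNH hk⟩⁻¹ : H)⁻¹ * ⟨z⁻¹ * b * z, hz⟩ :=
          Subtype.ext hle
        rw [← el]
        exact hl
      · refine ⟨N, hN, Or.inr ?_⟩
        intro k hk hmem
        apply hz
        have : k * b * k⁻¹ ∈ H := H.mul_mem (H.mul_mem (hNH hk) hbH) (H.inv_mem (hNH hk))
        have := H.mul_mem this (hNH hmem)
        rwa [mul_inv_cancel_left] at this)
    N hN
  have hn' := hN'.1
  refine ⟨N', hN', hle, fun c hc => ?_⟩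
  set z := (QuotientGroup.mk c : B ⧸ N).out with hzdef
  have hzc : z⁻¹ * c ∈ N := by
    rw [← QuotientGroup.eq]; exact Quotient.out_eq' _
  rcases hq (QuotientGroup.mk c) trivial with ⟨c1, h1, h2⟩ | h
  · refine ⟨c1, h1, ?_⟩
    have := N.mul_mem h2 hzc
    rwa [← hzdef, mul_assoc, mul_inv_cancel_left] at this
  · exfalso
    refine h (z⁻¹ * c) hzc ?_
    have e : ((z⁻¹ * c) * b * (z⁻¹ * c)⁻¹)⁻¹ * (z⁻¹ * b * z)
      = z⁻¹ * ((c * b⁻¹ * c⁻¹) * b) * z := by group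
    show ((z⁻¹ * c) * b * (z⁻¹ * c)⁻¹)⁻¹ * (z⁻¹ * b * z) ∈ N'
    rw [e]
    have h5 := hn'.conj_mem _ (N'.inv_mem hc) b⁻¹
    have h6 := hn'.conj_mem _ h5 (z⁻¹)
    have h7 := hn'.conj_mem _ (N'.inv_mem hc) (z⁻¹ * b⁻¹)
    convert h7 using 1
    group

end coC

section wr
open Classical
variable {A B : Type u} [CommGroup A] [Group B]

lemma act_apply (c : B) (f : WreathBase A B) (x : B) :
    ((wreathAction A B c f : WreathBase A B) : B → A) x = (f : B → A) (c⁻¹ * x) := rfl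

noncomputable def sgl (x : B) : A →* WreathBase A B where
  toFun a := ⟨fun y => if y = x then a else 1, (Set.finite_singleton x).subset (by
    intro y hy
    by_contra hne
    exact hy (if_neg hne))⟩
  map_one' := Subtype.ext (by funext y; simp)
  map_mul' a a' := Subtype.ext (by
    funext y
    show (if y = x then a * a' else 1) = (if y = x then a else 1) * (if y = x then a' else 1)
    split_ifs <;> simp)

lemma sgl_apply (x : B) (a : A) (y : B) :
    ((sgl x a : WreathBase A B) : B → A) y = if y = x then a else 1 := rfl

lemma act_sgl (c x : B) (a : A) : wreathAction A B c (sgl x a) = sgl (c * x) a := by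
  apply Subtype.ext
  funext y
  rw [act_apply, sgl_apply, sgl_apply]
  congr 1
  rw [inv_mul_eq_iff_eq_mul]

def ev (x : B) : WreathBase A B →* A := (Pi.evalMonoidHom (fun _ : B => A) x).comp
  (WreathBase A B).subtype

lemma mem_of_sgl (H : Subgroup (WreathBase A B)) (φ : WreathBase A B)
    (hφ : ∀ x, sgl x ((φ : B → A) x) ∈ H) : φ ∈ H := by
  have hfin : (Function.mulSupport (φ : B → A)).Finite := φ.2
  have e : φ = ∏ x ∈ hfin.toFinset, sgl x ((φ : B → A) x) := by
    apply Subtype.ext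
    funext y
    show ev y φ = ev y (∏ x ∈ hfin.toFinset, sgl x ((φ : B → A) x))
    rw [map_prod]
    have : ∀ x, ev y (sgl x ((φ : B → A) x)) = if y = x then (φ : B → A) x else 1 :=
      fun x => sgl_apply _ _ _
    simp only [this]
    rw [Finset.prod_ite_eq]
    split_ifs with h
    · rfl
    · show (φ : B → A) y = 1
      simpa using h
  rw [e]
  exact Subgroup.prod_mem _ (fun x _ => hφ x)

lemma hom_ext {C : Type*} [Group C] (f g : WreathBase A B →* C)
    (h : ∀ x a, f (sgl x a) = g (sgl x a)) : f = g := by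
  ext φ
  exact mem_of_sgl (f.eqLocus g) φ (fun x => h x _)

noncomputable def P (D : Subgroup B) : WreathBase A B →* (B → A) where
  toFun φ z := ∏ᶠ y, if z * y⁻¹ ∈ D then (φ : B → A) y else 1
  map_one' := by
    funext z
    simp
  map_mul' φ ψ := by
    funext z
    show (∏ᶠ y, if z * y⁻¹ ∈ D then (φ : B → A) y * (ψ : B → A) y else 1) =
      (∏ᶠ y, if z * y⁻¹ ∈ D then (φ : B → A) y else 1) *
      (∏ᶠ y, if z * y⁻¹ ∈ D then (ψ : B → A) y else 1)
    rw [← finprod_mul_distrib]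
    · apply finprod_congr
      intro y
      split_ifs <;> simp
    · refine φ.2.subset ?_
      intro y hy
      by_contra hne
      apply hy
      have : (φ : B → A) y = 1 := by simpa using hne
      simp [this]
    · refine ψ.2.subset ?_
      intro y hy
      by_contra hne
      apply hy
      have : (ψ : B → A) y = 1 := by simpa using hne
      simp [this]

lemma P_def (D : Subgroup B) (φ : WreathBase A B) (z : B) :
    P D φ z = ∏ᶠ y, if z * y⁻¹ ∈ D then (φ : B → A) y else 1 := rfl

lemma P_sgl (D : Subgroup B) (x : B) (a : A) (z : B) :
    P D (sgl x a) z = if z * x⁻¹ ∈ D then a else 1 := by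
  rw [P_def, finprod_eq_single _ x]
  · simp [sgl_apply]
  · intro y hy
    simp [sgl_apply, hy]

lemma P_ne_one {D : Subgroup B} {φ : WreathBase A B} {z : B} (h : P D φ z ≠ 1) :
    ∃ s, (φ : B → A) s ≠ 1 ∧ z * s⁻¹ ∈ D := by
  by_contra hcon
  push Not at hcon
  apply h
  rw [P_def]
  apply finprod_eq_one_of_forall_eq_one
  intro y
  split_ifs with hy
  · by_contra hne
    exact hcon y hne hy
  · rfl

lemma P_congr_left (D : Subgroup B) (φ : WreathBase A B) {z z' : B} (h : z * z'⁻¹ ∈ D) :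
    P D φ z = P D φ z' := by
  rw [P_def, P_def]
  apply finprod_congr
  intro y
  have : z * y⁻¹ ∈ D ↔ z' * y⁻¹ ∈ D := by
    rw [show z * y⁻¹ = (z * z'⁻¹) * (z' * y⁻¹) by group]
    exact Subgroup.mul_mem_cancel_left _ h
  simp [this]

lemma P_act (D : Subgroup B) (c : B) (hc : ∀ d, c * d * c⁻¹ ∈ D ↔ d ∈ D)
    (φ : WreathBase A B) (z : B) : P D (wreathAction A B c φ) z = P D φ (c⁻¹ * z) := by
  let e := (Pi.evalMonoidHom (fun _ : B => A))
  have : ((e z).comp (P D)).comp (wreathAction A B c).toMonoidHom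
      = (e (c⁻¹ * z)).comp (P D) := by
    apply hom_ext
    intro x a
    show P D (wreathAction A B c (sgl x a)) z = P D (sgl x a) (c⁻¹ * z)
    rw [act_sgl, P_sgl, P_sgl, ← hc (c⁻¹ * z * x⁻¹)]
    congr 2
    group
  exact DFunLike.congr_fun this φ

/-- kernel of the map to `(A/M)[D\B]`. -/
noncomputable def J (D : Subgroup B) (M : Subgroup A) : Subgroup (WreathBase A B) :=
  (Subgroup.pi Set.univ (fun _ : B => M)).comap (P D)

lemma mem_J {D : Subgroup B} {M : Subgroup A} {φ : WreathBase A B} :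
    φ ∈ J D M ↔ ∀ z, P D φ z ∈ M := by
  simp [J, Subgroup.mem_pi]

lemma sgl_mem_J (D : Subgroup B) {M : Subgroup A} (x : B) {a : A} (ha : a ∈ M) :
    sgl x a ∈ J D M := by
  rw [mem_J]
  intro z
  rw [P_sgl]
  split_ifs
  · exact ha
  · exact M.one_mem

lemma sgl_div_mem_J {D : Subgroup B} (M : Subgroup A) {x x' : B} (a : A)
    (h : x * x'⁻¹ ∈ D) : sgl x a / sgl x' a ∈ J D M := by
  rw [mem_J]
  intro z
  rw [map_div, Pi.div_apply, P_sgl, P_sgl]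
  have : z * x'⁻¹ ∈ D ↔ z * x⁻¹ ∈ D := by
    rw [show z * x'⁻¹ = (z * x⁻¹) * (x * x'⁻¹) by group]
    exact Subgroup.mul_mem_cancel_right _ h
  simp [this, M.one_mem]

noncomputable def rep (D : Subgroup B) (x : B) : B :=
  Quotient.out (Quotient.mk (QuotientGroup.rightRel D) x)

lemma rep_mem (D : Subgroup B) (x : B) : x * (rep D x)⁻¹ ∈ D := by
  have : (QuotientGroup.rightRel D) (rep D x) x := Quotient.mk_out (s := QuotientGroup.rightRel D) x
  rwa [QuotientGroup.rightRel_apply] at this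

lemma rep_congr (D : Subgroup B) {x y : B} (h : x * y⁻¹ ∈ D) : rep D x = rep D y := by
  unfold rep
  congr 1
  symm
  apply Quotient.sound
  show (QuotientGroup.rightRel D) y x
  rwa [QuotientGroup.rightRel_apply]

noncomputable def rr (D : Subgroup B) : WreathBase A B →* WreathBase A B where
  toFun φ := ⟨fun x => if rep D x = x then P D φ x else 1, by
    refine (φ.2.image (rep D)).subset ?_
    intro x hx
    have hx' : (if rep D x = x then P D φ x else 1) ≠ 1 := hx
    split_ifs at hx' with h1
    · obtain ⟨s, hs, hs'⟩ := P_ne_one hx'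
      exact ⟨s, hs, by rw [← rep_congr D hs', h1]⟩
    · exact absurd rfl hx'⟩
  map_one' := Subtype.ext (by funext x; simp)
  map_mul' φ ψ := Subtype.ext (by
    funext x
    show (if rep D x = x then P D (φ * ψ) x else 1) =
      (if rep D x = x then P D φ x else 1) * (if rep D x = x then P D ψ x else 1)
    split_ifs <;> simp)

lemma rr_apply (D : Subgroup B) (φ : WreathBase A B) (x : B) :
    ((rr D φ : WreathBase A B) : B → A) x = if rep D x = x then P D φ x else 1 := rfl

lemma rr_sgl (D : Subgroup B) (x : B) (a : A) : rr D (sgl x a) = sgl (rep D x) a := by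
  apply Subtype.ext
  funext y
  rw [rr_apply, sgl_apply, P_sgl]
  by_cases h : y = rep D x
  · have h1 : rep D y = y := by
      rw [h]; exact (rep_congr D (rep_mem D x)).symm
    have h2 : y * x⁻¹ ∈ D := by
      have := D.inv_mem (rep_mem D x)
      rw [h]; simpa using this
    rw [if_pos h1, if_pos h2, if_pos h]
  · rw [if_neg h]
    split_ifs with h1 h2
    · exact absurd (h1.symm.trans (rep_congr D h2)) h
    · rfl
    · rfl

lemma J_le (D : Subgroup B) (M : Subgroup A) (H : Subgroup (WreathBase A B))
    (h1 : ∀ x, ∀ a ∈ M, sgl x a ∈ H)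
    (h2 : ∀ x, ∀ d ∈ D, ∀ a, sgl (d * x) a / sgl x a ∈ H) : J D M ≤ H := by
  intro φ hφ
  have ha : rr D φ ∈ H := by
    apply mem_of_sgl
    intro x
    apply h1
    rw [rr_apply]
    split_ifs
    · exact mem_J.mp hφ x
    · exact M.one_mem
  have hb : φ / rr D φ ∈ H := by
    have : φ ∈ H.comap (MonoidHom.id _ / rr D) := by
      apply mem_of_sgl
      intro x
      show sgl x _ / rr D (sgl x _) ∈ H
      rw [rr_sgl]
      have := h2 (rep D x) _ (rep_mem D x) ((φ : B → A) x)
      rwa [inv_mul_cancel_right] at this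
    exact this
  simpa using H.mul_mem hb ha

lemma J_mono {D E : Subgroup B} {M M' : Subgroup A} (hD : D ≤ E) (hM : M ≤ M') :
    J D M ≤ J E M' := by
  apply J_le
  · intro x a ha
    exact sgl_mem_J _ _ (hM ha)
  · intro x d hd a
    exact sgl_div_mem_J _ _ (by simpa using hD hd)

lemma act_mem_J {D : Subgroup B} {M : Subgroup A} {c : B}
    (hc : ∀ d, c * d * c⁻¹ ∈ D ↔ d ∈ D) {φ : WreathBase A B} (h : φ ∈ J D M) :
    wreathAction A B c φ ∈ J D M := by
  rw [mem_J] at *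
  intro z
  rw [P_act D c hc]
  exact h _

lemma act_div_mem_J {D : Subgroup B} (M : Subgroup A) {d : B} (hd : d ∈ D)
    (φ : WreathBase A B) : wreathAction A B d φ / φ ∈ J D M := by
  have hc : ∀ x, d * x * d⁻¹ ∈ D ↔ x ∈ D := fun x => by
    rw [Subgroup.mul_mem_cancel_right _ (D.inv_mem hd), Subgroup.mul_mem_cancel_left _ hd]
  rw [mem_J]
  intro z
  rw [map_div, Pi.div_apply, P_act D d hc, P_congr_left D φ (z := d⁻¹ * z) (z' := z)]
  · simp [M.one_mem]
  · simpa using hd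

lemma exists_cobound (b : B) (φ : WreathBase A B) (h : φ ∈ J (Subgroup.zpowers b) ⊥) :
    ∃ f, wreathAction A B b f / f = φ := by
  let δ : WreathBase A B →* WreathBase A B :=
    (wreathAction A B b).toMonoidHom / MonoidHom.id _
  have : J (Subgroup.zpowers b) (⊥ : Subgroup A) ≤ δ.range := by
    apply J_le
    · intro x a ha
      rw [Subgroup.mem_bot.mp ha, map_one]
      exact Subgroup.one_mem _
    · intro x d hd a
      have hstep : ∀ x : B, sgl (b * x) a / sgl x a ∈ δ.range := fun x =>
        ⟨sgl x a, by
          show wreathAction A B b (sgl x a) / sgl x a = _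
          rw [act_sgl]⟩
      obtain ⟨k, rfl⟩ := Subgroup.mem_zpowers_iff.mp hd
      induction k using Int.induction_on with
      | zero => simp
      | succ i ih =>
        have := Subgroup.mul_mem _ (hstep (b ^ (i : ℤ) * x)) (ih ⟨_, rfl⟩)
        rw [div_mul_div_cancel] at this
        rwa [add_comm, zpow_add, zpow_one, mul_assoc]
      | pred i ih =>
        have := Subgroup.mul_mem _ (Subgroup.inv_mem _ (hstep (b ^ (-(i : ℤ) - 1) * x)))
          (ih ⟨_, rfl⟩)
        rw [inv_div, ← mul_assoc, ← zpow_one_add, add_sub_cancel, div_mul_div_cancel] at this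
        exact this
  exact this h

end wr

section main
open Classical
variable {A B : Type u} [CommGroup A] [Group B]

noncomputable def Orb (b : B) (n : ℕ) (y : B) (a : A) : WreathBase A B :=
  ∏ i ∈ Finset.range n, sgl (b ^ i * y) a

lemma P_orb (b : B) (N : Subgroup B) [N.Normal] (n : ℕ) (hn : 0 < n)
    (hord : ∀ k : ℤ, b ^ k ∈ N ↔ (n : ℤ) ∣ k) (y : B) (a : A) (z : B) :
    P N (Orb b n y a) z = if z * y⁻¹ ∈ Subgroup.zpowers b ⊔ N then a else 1 := by
  unfold Orb
  rw [map_prod, Finset.prod_apply]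
  simp only [P_sgl]
  split_ifs with h
  · obtain ⟨x, hx, m, hm, hxm⟩ := Subgroup.mem_sup_of_normal_left.mp (sup_comm _ N ▸ h)
    obtain ⟨k, rfl⟩ := Subgroup.mem_zpowers_iff.mp hm
    have hn0 : (n : ℤ) ≠ 0 := by omega
    have hk0 := Int.emod_nonneg k hn0
    have hk1 := Int.emod_lt_of_pos k (show (0 : ℤ) < n by omega)
    have key : ∀ i : ℕ, z * (b ^ i * y)⁻¹ ∈ N ↔ (n : ℤ) ∣ k - i := by
      intro i
      rw [← hord, mul_inv_rev, ← mul_assoc, ← hxm, mul_assoc, Subgroup.mul_mem_cancel_left _ hx,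
        zpow_sub, zpow_natCast]
    rw [Finset.prod_eq_single (k % n).toNat]
    · rw [if_pos]
      rw [key, Int.toNat_of_nonneg hk0]
      exact Int.dvd_self_sub_emod
    · intro i hi hne
      rw [if_neg]
      rw [key]
      intro hd
      apply hne
      have h2 : (i : ℤ) % n = k % n := (Int.emod_eq_emod_iff_emod_sub_eq_zero.mpr (Int.emod_eq_zero_of_dvd hd)).symm
      rw [Finset.mem_range] at hi
      rw [← h2, Int.emod_eq_of_lt (by omega) (by omega)]
      simp
    · intro hnot
      exfalso
      apply hnot
      rw [Finset.mem_range]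
      omega
  · apply Finset.prod_eq_one
    intro i _
    rw [if_neg]
    intro h'
    apply h
    have : z * y⁻¹ = (z * (b ^ i * y)⁻¹) * b ^ i := by group
    rw [this]
    exact Subgroup.mul_mem _ ((le_sup_right : N ≤ _) h')
      ((le_sup_left : Subgroup.zpowers b ≤ _) (Subgroup.pow_mem _ (Subgroup.mem_zpowers b) i))

lemma orbit_decomp (b : B) (N : Subgroup B) [hN : N.Normal] [Finite (B ⧸ N)] (n : ℕ) (hn : 0 < n)
    (hord : ∀ k : ℤ, b ^ k ∈ N ↔ (n : ℤ) ∣ k) (M : Subgroup A) (φ : WreathBase A B)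
    (hφ : wreathAction A B b φ / φ ∈ J N M) (H : Subgroup (WreathBase A B)) (h1 : J N M ≤ H)
    (h2 : ∀ y a, Orb b n y a ∈ H) : φ ∈ H := by
  set D := Subgroup.zpowers b ⊔ N with hD
  have hfin : (Set.range (rep D)).Finite := by
    refine (Set.finite_range (fun q : B ⧸ N => rep D q.out)).subset ?_
    rintro _ ⟨x, rfl⟩
    refine ⟨QuotientGroup.mk x, rep_congr D ?_⟩
    have : (QuotientGroup.mk x : B ⧸ N).out⁻¹ * x ∈ N := by
      rw [← QuotientGroup.eq]; exact Quotient.out_eq' _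
    have h3 := hN.conj_mem _ (N.inv_mem this) x
    apply (le_sup_right : N ≤ D)
    convert h3 using 1
    group
  set F := P N φ with hF
  set ψ : WreathBase A B := ∏ y ∈ hfin.toFinset, Orb b n y (F y) with hψ
  have hψH : ψ ∈ H := Subgroup.prod_mem _ (fun y _ => h2 _ _)
  have hPψ : ∀ z, P N ψ z = F (rep D z) := by
    intro z
    rw [hψ, map_prod, Finset.prod_apply, Finset.prod_eq_single (rep D z)]
    · rw [P_orb b N n hn hord, if_pos (rep_mem D z)]
    · intro y hy hne
      rw [P_orb b N n hn hord, if_neg]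
      intro hmem
      apply hne
      rw [rep_congr D hmem]
      obtain ⟨x, rfl⟩ := hfin.mem_toFinset.mp hy
      exact rep_congr D (rep_mem D x)
    · intro hnot
      exact absurd (hfin.mem_toFinset.mpr ⟨z, rfl⟩) hnot
  have hnormal : ∀ d, b * d * b⁻¹ ∈ N ↔ d ∈ N := fun d => (hN.mem_comm_iff).trans (by simp)
  have hinv : ∀ z, F (b⁻¹ * z) / F z ∈ M := by
    intro z
    have := mem_J.mp hφ z
    rwa [map_div, Pi.div_apply, P_act N b hnormal] at this
  let S : Subgroup B :=
    { carrier := {d | ∀ z, F (d * z) / F z ∈ M}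
      one_mem' := by intro z; simp
      mul_mem' := by
        intro d d' hd hd' z
        have := M.mul_mem (hd (d' * z)) (hd' z)
        rwa [div_mul_div_cancel, ← mul_assoc] at this
      inv_mem' := by
        intro d hd z
        have := M.inv_mem (hd (d⁻¹ * z))
        rwa [inv_div, mul_inv_cancel_left] at this }
  have hDS : D ≤ S := by
    apply sup_le
    · rw [Subgroup.zpowers_le]
      have : b⁻¹ ∈ S := hinv
      simpa using S.inv_mem this
    · intro d hd z
      rw [hF, P_congr_left N φ (z := d * z) (z' := z) (by simpa using hd)]
      simp
  have hJ : φ / ψ ∈ J N M := by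
    rw [mem_J]
    intro z
    rw [map_div, Pi.div_apply, hPψ]
    have := hDS (rep_mem D z) (rep D z)
    rwa [inv_mul_cancel_right] at this
  simpa using H.mul_mem (h1 hJ) hψH

lemma exists_ord (V : ECPseudoVariety.{u}) (b : B) {N : Subgroup B} (hN : N ∈ V.coC B) :
    ∃ n : ℕ, 0 < n ∧ ∀ k : ℤ, b ^ k ∈ N ↔ (n : ℤ) ∣ k := by
  obtain ⟨hn, hm⟩ := hN
  have := V.finite _ hm
  refine ⟨orderOf (QuotientGroup.mk b : B ⧸ N), orderOf_pos _, fun k => ?_⟩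
  rw [orderOf_dvd_iff_zpow_eq_one, ← QuotientGroup.mk_zpow, QuotientGroup.eq_one_iff]

lemma sep_zpowers (V : ECPseudoVariety.{u})
    (hcyc : ∀ x : B, V.CSeparable ((Subgroup.zpowers x : Subgroup B) : Set B))
    (b x : B) (hx : x ∉ Subgroup.zpowers b) :
    ∃ N ∈ V.coC B, x ∉ Subgroup.zpowers b ⊔ N := by
  obtain ⟨N, hN, h⟩ := hcyc b x hx
  have hn := hN.1
  refine ⟨N, hN, fun hmem => h ?_⟩
  obtain ⟨y, hy, z, hz, rfl⟩ := Subgroup.mem_sup_of_normal_right.mp hmem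
  exact ⟨y, hy, QuotientGroup.eq.mpr (by simpa using hz)⟩

lemma sep_one (V : ECPseudoVariety.{u})
    (hcyc : ∀ x : B, V.CSeparable ((Subgroup.zpowers x : Subgroup B) : Set B))
    (x : B) (hx : x ≠ 1) : ∃ N ∈ V.coC B, x ∉ N := by
  obtain ⟨N, hN, h⟩ := sep_zpowers V hcyc 1 x (by simpa using hx)
  exact ⟨N, hN, fun h' => h ((le_sup_right : N ≤ _) h')⟩

lemma prod_periodic {Q : Type*} [CommGroup Q] (g : ℕ → Q) (m : ℕ) (hg : ∀ i, g (i + m) = g i)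
    (k : ℕ) : ∏ i ∈ Finset.range (m * k), g i = (∏ i ∈ Finset.range m, g i) ^ k := by
  have hg' : ∀ k i, g (m * k + i) = g i := by
    intro k
    induction k with
    | zero => simp
    | succ k ih => intro i; rw [← ih i, ← hg (m * k + i)]; congr 1; ring
  induction k with
  | zero => simp
  | succ k ih =>
    rw [Nat.mul_succ, Finset.prod_range_add, ih, pow_succ]
    simp only [hg']

lemma orb_good (V : ECPseudoVariety.{u})
    (hcyc : ∀ x : B, V.CSeparable ((Subgroup.zpowers x : Subgroup B) : Set B))
    (b : B) (N : Subgroup B) (hN : N ∈ V.coC B) (M : Subgroup A) (hM : M ∈ V.coC A) :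
    ∃ N2 ∈ V.coC B, N2 ≤ N ∧ ∃ n : ℕ, 0 < n ∧ (∀ k : ℤ, b ^ k ∈ N2 ↔ (n : ℤ) ∣ k) ∧
      ∀ y a, wreathAction A B b (Orb b n y a) = Orb b n y a ∨ Orb b n y a ∈ J N M := by
  by_cases hb : IsOfFinOrder b
  · have hr := hb.orderOf_pos
    obtain ⟨N2, hN2, hle, hq⟩ := exists_fin V (Set.Ioo 0 (orderOf b)) (Set.finite_Ioo _ _)
      (fun i L => b ^ i ∉ L) (fun i L L' h h' h'' => h' (h h''))
      (fun i hi => sep_one V hcyc _ (pow_ne_one_of_lt_orderOf (by have := hi.1; omega) hi.2)) N hN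
    obtain ⟨n, hn, hord⟩ := exists_ord V b hN2
    refine ⟨N2, hN2, hle, n, hn, hord, fun y a => Or.inl ?_⟩
    have hbn : b ^ n = 1 := by
      have h1 : b ^ n ∈ N2 := by
        have := (hord n).mpr dvd_rfl
        simpa using this
      by_contra hne
      rw [← pow_mod_orderOf] at h1 hne
      refine hq (n % orderOf b) ⟨?_, Nat.mod_lt _ hr⟩ h1
      rcases Nat.eq_zero_or_pos (n % orderOf b) with h | h
      · rw [h] at hne; simp at hne
      · exact h
    unfold Orb
    rw [map_prod]
    simp only [act_sgl, ← mul_assoc, ← pow_succ']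
    have e1 := Finset.prod_range_succ (fun i => sgl (b ^ i * y) a) n
    have e2 := Finset.prod_range_succ' (fun i => sgl (b ^ i * y) a) n
    rw [e1] at e2
    simp only [hbn, pow_zero] at e2
    exact (mul_right_cancel e2).symm
  · obtain ⟨m, hm, hmord⟩ := exists_ord V b hN
    have hMf := V.finite _ hM.2
    set e := Nat.card (A ⧸ M) with he
    have he0 : 0 < e := Nat.card_pos
    have hinj : Function.Injective (fun i : ℤ => b ^ i) := injective_zpow_iff_not_isOfFinOrder.mpr hb
    obtain ⟨N2, hN2, hle, hq⟩ := exists_fin V (Set.Ioo 0 (m * e)) (Set.finite_Ioo _ _)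
      (fun i L => b ^ i ∉ Subgroup.zpowers (b ^ (m * e)) ⊔ L)
      (fun i L L' h h' h'' => h' (sup_le_sup_left h _ h''))
      (fun i hi => sep_zpowers V hcyc _ _ (by
        intro hmem
        obtain ⟨k, hk⟩ := Subgroup.mem_zpowers_iff.mp hmem
        have h3 : ((m * e : ℕ) : ℤ) * k = (i : ℤ) := hinj (by
          show b ^ (((m * e : ℕ) : ℤ) * k) = b ^ (i : ℤ)
          rw [zpow_mul, zpow_natCast, zpow_natCast]
          exact hk)
        have h4 : ((m * e : ℕ) : ℤ) ∣ (i : ℤ) := ⟨k, h3.symm⟩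
        have h5 := Nat.le_of_dvd hi.1 (Int.natCast_dvd_natCast.mp h4)
        have := hi.2
        omega)) N hN
    obtain ⟨n, hn, hord⟩ := exists_ord V b hN2
    refine ⟨N2, hN2, hle, n, hn, hord, fun y a => Or.inr ?_⟩
    have h1 : b ^ n ∈ N2 := by
      have := (hord n).mpr dvd_rfl
      simpa using this
    have hdvd : m * e ∣ n := by
      by_contra hnd
      refine hq (n % (m * e)) ⟨?_, Nat.mod_lt _ (Nat.mul_pos hm he0)⟩ ?_
      · exact Nat.pos_of_ne_zero (fun h => hnd (Nat.dvd_of_mod_eq_zero h))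
      · have h6 : b ^ (n % (m * e)) = ((b ^ (m * e)) ^ (n / (m * e)))⁻¹ * b ^ n := by
          rw [eq_inv_mul_iff_mul_eq, ← pow_mul, ← pow_add, Nat.div_add_mod]
        rw [h6]
        exact Subgroup.mul_mem _ (Subgroup.inv_mem _ ((le_sup_left : Subgroup.zpowers _ ≤ _)
          (Subgroup.pow_mem _ (Subgroup.mem_zpowers _) _))) ((le_sup_right : N2 ≤ _) h1)
    obtain ⟨q, rfl⟩ := hdvd
    rw [← QuotientGroup.eq_one_iff]
    unfold Orb
    show QuotientGroup.mk' (J N M) _ = 1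
    rw [map_prod, mul_assoc, prod_periodic _ m, pow_mul, ← Finset.prod_pow]
    · rw [Finset.prod_eq_one, one_pow]
      intro i _
      rw [← map_pow, ← map_pow]
      apply (QuotientGroup.eq_one_iff _).mpr
      apply sgl_mem_J
      rw [← QuotientGroup.eq_one_iff, QuotientGroup.mk_pow]
      exact pow_card_eq_one'
    · intro i
      rw [← div_eq_one, ← map_div]
      apply (QuotientGroup.eq_one_iff _).mpr
      apply sgl_div_mem_J
      rw [pow_add]
      have hbm : b ^ m ∈ N := by
        have := (hmord m).mpr dvd_rfl
        simpa using this
      have := hN.1.conj_mem _ hbm (b ^ i)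
      convert this using 1
      group

lemma norm_aux (b c : B) (N D : Subgroup B) [hN : N.Normal] (hD : D = Subgroup.zpowers b ⊔ N)
    (hc : c * b * c⁻¹ ∈ D) (d : B) (hd : d ∈ D) : c * d * c⁻¹ ∈ D := by
  have : D ≤ D.comap (MulAut.conj c).toMonoidHom := by
    conv_lhs => rw [hD]
    apply sup_le
    · rw [Subgroup.zpowers_le]; exact hc
    · intro x hx
      show c * x * c⁻¹ ∈ D
      rw [hD]
      exact (le_sup_right : N ≤ _) (hN.conj_mem _ hx c)
  exact this hd

lemma main_sel (V : ECPseudoVariety.{u}) (hresA : V.Residually A) (hB : V.HCS B)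
    (hcyc : ∀ x : B, V.CSeparable ((Subgroup.zpowers x : Subgroup B) : Set B))
    (h : WreathBase A B) (b : B) (N2 : Subgroup B) (hN2 : N2 ∈ V.coC B) (M : Subgroup A)
    (hM : M ∈ V.coC A) :
    ∃ N' ∈ V.coC B, N' ≤ N2 ∧ ∃ M' ∈ V.coC A, M' ≤ M ∧ ∀ c, c * b * (b * c)⁻¹ ∈ N' →
      wreathAction A B c h / h ∈ J (Subgroup.zpowers b ⊔ N') M' →
      ∃ c1, c1 * b = b * c1 ∧ c1⁻¹ * c ∈ N2 ∧
        wreathAction A B c1 h / h ∈ J (Subgroup.zpowers b) ⊥ := by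
  have hnorm1 : ∀ c1, c1 * b = b * c1 →
      ∀ d, c1 * d * c1⁻¹ ∈ Subgroup.zpowers b ↔ d ∈ Subgroup.zpowers b := by
    intro c1 hc1
    have hcomm : Commute c1 b := hc1
    have hall : ∀ c : B, Commute c b → ∀ d ∈ Subgroup.zpowers b, c * d * c⁻¹ ∈ Subgroup.zpowers b := by
      intro c hc d hd
      obtain ⟨k, rfl⟩ := Subgroup.mem_zpowers_iff.mp hd
      rw [(hc.zpow_right k).eq, mul_inv_cancel_right]
      exact hd
    intro d
    refine ⟨fun hd => ?_, hall c1 hcomm d⟩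
    have := hall c1⁻¹ hcomm.inv_left _ hd
    convert this using 1
    group
  set p := P (Subgroup.zpowers b) h with hp
  by_cases htriv : ∀ z, p z = 1
  · obtain ⟨N', hN', hle, hcc⟩ := CC_of_HCS V hB b N2 hN2
    refine ⟨N', hN', hle, M, hM, le_rfl, fun c hc _ => ?_⟩
    obtain ⟨c1, h1, h2⟩ := hcc c hc
    refine ⟨c1, h1, h2, ?_⟩
    rw [mem_J]
    intro z
    rw [map_div, Pi.div_apply, P_act _ _ (hnorm1 c1 h1)]
    change p _ / p _ ∈ _
    rw [htriv, htriv]; simp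
  push Not at htriv
  obtain ⟨z0, hz0⟩ := htriv
  have hSf : (Function.mulSupport (h : B → A)).Finite := h.2
  set S := Function.mulSupport (h : B → A) with hS
  -- choose N'
  obtain ⟨N1, hN1, hN1le, hN1q⟩ := exists_fin V
    ((fun q : (B × B) × (B × B) => (q.1.1 * q.1.2⁻¹) * (q.2.1 * q.2.2⁻¹)⁻¹) ''
      ((S ×ˢ S) ×ˢ (S ×ˢ S))) (((hSf.prod hSf).prod (hSf.prod hSf)).image _)
    (fun x L => x ∈ Subgroup.zpowers b ⊔ L → x ∈ Subgroup.zpowers b)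
    (fun i L L' h h' h'' => h' (sup_le_sup_left h _ h''))
    (fun x _ => by
      by_cases hx : x ∈ Subgroup.zpowers b
      · exact ⟨N2, hN2, fun _ => hx⟩
      · obtain ⟨L, hL, hLx⟩ := sep_zpowers V hcyc b x hx
        exact ⟨L, hL, fun h => absurd h hLx⟩) N2 hN2
  obtain ⟨N', hN', hN'le, hN'q⟩ := exists_fin V (S ×ˢ S) (hSf.prod hSf)
    (fun q L => (q.1 * q.2⁻¹) * b * (b * (q.1 * q.2⁻¹))⁻¹ ∈ L →
      (q.1 * q.2⁻¹) * b * (b * (q.1 * q.2⁻¹))⁻¹ = 1)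
    (fun i L L' h h' h'' => h' (h h''))
    (fun q _ => by
      by_cases hx : (q.1 * q.2⁻¹) * b * (b * (q.1 * q.2⁻¹))⁻¹ = 1
      · exact ⟨N2, hN2, fun _ => hx⟩
      · obtain ⟨L, hL, hLx⟩ := sep_one V hcyc _ hx
        exact ⟨L, hL, fun h => absurd h hLx⟩) N1 hN1
  have hsep4 : ∀ s ∈ S, ∀ t ∈ S, ∀ u ∈ S, ∀ v ∈ S,
      (s * t⁻¹) * (u * v⁻¹)⁻¹ ∈ Subgroup.zpowers b ⊔ N' →
      (s * t⁻¹) * (u * v⁻¹)⁻¹ ∈ Subgroup.zpowers b := by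
    intro s hs t ht u hu v hv hmem
    exact hN1q _ ⟨((s, t), (u, v)), ⟨⟨hs, ht⟩, ⟨hu, hv⟩⟩, rfl⟩ (sup_le_sup_left hN'le _ hmem)
  have hsep2 : ∀ s ∈ S, ∀ t ∈ S, s * t⁻¹ ∈ Subgroup.zpowers b ⊔ N' →
      s * t⁻¹ ∈ Subgroup.zpowers b := by
    intro s hs t ht hmem
    have := hsep4 s hs t ht s hs s hs
    simp only [mul_inv_cancel, inv_one, mul_one] at this
    exact this hmem
  have hsepc : ∀ s ∈ S, ∀ t ∈ S, (s * t⁻¹) * b * (b * (s * t⁻¹))⁻¹ ∈ N' →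
      (s * t⁻¹) * b = b * (s * t⁻¹) := by
    intro s hs t ht hmem
    exact mul_inv_eq_one.mp (hN'q (s, t) ⟨hs, ht⟩ hmem)
  -- choose M'
  obtain ⟨M', hM', hM'le, hM'q⟩ := exists_fin V
    ((p '' S) ∪ (fun q : B × B => p q.1 / p q.2) '' (S ×ˢ S))
    ((hSf.image _).union ((hSf.prod hSf).image _))
    (fun x L => x ∈ L → x = 1) (fun i L L' h h' h'' => h' (h h''))
    (fun x _ => by
      by_cases hx : x = 1
      · exact ⟨M, hM, fun _ => hx⟩
      · obtain ⟨L, hL, hLx⟩ := hresA _ hx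
        exact ⟨L, hL, fun h => absurd h hLx⟩) M hM
  have hM1 : ∀ s ∈ S, p s ∈ M' → p s = 1 := fun s hs => hM'q _ (Or.inl ⟨s, hs, rfl⟩)
  have hM2 : ∀ s ∈ S, ∀ t ∈ S, p s / p t ∈ M' → p s = p t := fun s hs t ht hmem =>
    div_eq_one.mp (hM'q _ (Or.inr ⟨(s, t), ⟨hs, ht⟩, rfl⟩) hmem)
  refine ⟨N', hN', hN'le.trans hN1le, M', hM', hM'le, fun c hc hJ => ?_⟩
  have hN'n := hN'.1
  set D := Subgroup.zpowers b ⊔ N' with hD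
  have hbD : b ∈ D := (le_sup_left : Subgroup.zpowers b ≤ D) (Subgroup.mem_zpowers b)
  have hND : N' ≤ D := le_sup_right
  have hbD' : Subgroup.zpowers b ≤ D := le_sup_left
  -- c normalizes D
  have hcb : c * b * c⁻¹ ∈ D := by
    have := D.mul_mem (hND hc) hbD
    convert this using 1
    group
  have hcb' : c⁻¹ * b * c⁻¹⁻¹ ∈ D := by
    have h1 := hN'n.conj_mem _ (N'.inv_mem hc) c⁻¹
    have := D.mul_mem (hND h1) hbD
    convert this using 1
    group
  have hcn : ∀ d, c * d * c⁻¹ ∈ D ↔ d ∈ D := by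
    intro d
    refine ⟨fun hd => ?_, norm_aux b c N' D hD hcb d⟩
    have := norm_aux b c⁻¹ N' D hD hcb' _ hd
    convert this using 1
    group
  have hp' : ∀ s ∈ S, P D h s = p s := by
    intro s hs
    rw [hp, P_def, P_def]
    apply finprod_congr
    intro y
    by_cases hy : y ∈ S
    · have : s * y⁻¹ ∈ D ↔ s * y⁻¹ ∈ Subgroup.zpowers b := ⟨hsep2 s hs y hy, fun h => hbD' h⟩
      simp only [this]
    · have : (h : B → A) y = 1 := by simpa [hS] using hy
      simp [this]
  have hq : ∀ z, P D h (c⁻¹ * z) / P D h z ∈ M' := by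
    intro z
    have := mem_J.mp hJ z
    rwa [map_div, Pi.div_apply, P_act D c hcn] at this
  -- generic matching statement
  have match_aux : ∀ s ∈ S, p s ≠ 1 → ∀ z, P D h z / P D h s ∈ M' →
      ∃ t ∈ S, z * t⁻¹ ∈ D ∧ p t = p s := by
    intro s hs hps z hz
    have hne : P D h z ≠ 1 := by
      intro h1
      rw [h1, hp' s hs, one_div] at hz
      exact hps (hM1 s hs (by simpa using hz))
    obtain ⟨t, ht, hzt⟩ := P_ne_one hne
    refine ⟨t, ht, hzt, hM2 t ht s hs ?_⟩
    rwa [P_congr_left D h hzt, hp' t ht, hp' s hs] at hz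
  have fwd : ∀ s ∈ S, p s ≠ 1 → ∃ t ∈ S, c * (t * s⁻¹)⁻¹ ∈ D ∧ p t = p s := by
    intro s hs hps
    have h1 := M'.inv_mem (hq (c * s))
    rw [inv_div, inv_mul_cancel_left] at h1
    obtain ⟨t, ht, h2, h3⟩ := match_aux s hs hps _ h1
    refine ⟨t, ht, ?_, h3⟩
    convert h2 using 1
    group
  have bwd : ∀ t ∈ S, p t ≠ 1 → ∃ s ∈ S, c * (t * s⁻¹)⁻¹ ∈ D ∧ p s = p t := by
    intro t ht hpt
    obtain ⟨s, hs, h2, h3⟩ := match_aux t ht hpt _ (hq t)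
    refine ⟨s, hs, ?_, h3⟩
    have := D.inv_mem ((hcn _).mpr h2)
    convert this using 1
    group
  obtain ⟨s0, hs0, hzs0⟩ := P_ne_one hz0
  have hps0 : p s0 ≠ 1 := by
    rw [hp, ← P_congr_left _ h hzs0]; exact hz0
  obtain ⟨t0, ht0, hct0, -⟩ := fwd s0 hs0 hps0
  set u := t0 * s0⁻¹ with hu
  -- write c = b^j * n * u
  obtain ⟨bj, hbj, n, hn, hbn⟩ := Subgroup.mem_sup_of_normal_right.mp hct0
  have hcu : c = bj * n * u := by rw [hbn]; group
  obtain ⟨j, rfl⟩ := Subgroup.mem_zpowers_iff.mp hbj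
  have hub : u * b = b * u := by
    apply hsepc t0 ht0 s0 hs0
    show u * b * (b * u)⁻¹ ∈ N'
    rw [← QuotientGroup.eq_one_iff] at hc ⊢
    have hn1 : (QuotientGroup.mk n : B ⧸ N') = 1 := (QuotientGroup.eq_one_iff _).mpr hn
    rw [hcu] at hc
    simp only [QuotientGroup.mk_mul, QuotientGroup.mk_inv, QuotientGroup.mk_zpow, hn1,
      mul_one] at hc ⊢
    rw [mul_inv_eq_one] at hc ⊢
    have hcm := (Commute.self_zpow (QuotientGroup.mk b : B ⧸ N') j).eq
    rw [← mul_assoc, hcm, mul_assoc, mul_assoc] at hc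
    exact mul_left_cancel hc
  have hc1 : (b ^ j * u) * b = b * (b ^ j * u) := by
    have hcm := (Commute.self_zpow b j).eq
    rw [mul_assoc, hub, ← mul_assoc, ← hcm, mul_assoc]
  set c1 := b ^ j * u with hc1def
  have hnc := hnorm1 c1 hc1
  refine ⟨c1, hc1, ?_, ?_⟩
  · apply hN1le
    apply hN'le
    have := hN'n.conj_mem _ hn u⁻¹
    rw [hcu, hc1def]
    convert this using 1
    group
  have key : ∀ s ∈ S, ∀ t ∈ S, c * (t * s⁻¹)⁻¹ ∈ D → c1 * (t * s⁻¹)⁻¹ ∈ Subgroup.zpowers b := by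
    intro s hs t ht hmem
    have h1 : (t * s⁻¹) * (t0 * s0⁻¹)⁻¹ ∈ Subgroup.zpowers b := by
      apply hsep4 t ht s hs t0 ht0 s0 hs0
      have := D.mul_mem (D.inv_mem hmem) hct0
      convert this using 1
      rw [hu]
      group
    have := Subgroup.mul_mem _ hbj (Subgroup.inv_mem _ h1)
    convert this using 1
    rw [hc1def, hu]
    group
  have up : ∀ z, p z ≠ 1 → p (c1 * z) = p z := by
    intro z hz
    obtain ⟨s, hs, hzs⟩ := P_ne_one hz
    have hpz : p z = p s := P_congr_left _ h hzs
    obtain ⟨t, ht, h1, h2⟩ := fwd s hs (hpz ▸ hz)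
    rw [hpz, ← h2]
    apply P_congr_left
    have := Subgroup.mul_mem _ ((hnc _).mpr hzs) (key s hs t ht h1)
    convert this using 1
    group
  rw [mem_J]
  intro z
  rw [map_div, Pi.div_apply, P_act _ _ hnc, Subgroup.mem_bot, div_eq_one]
  show p (c1⁻¹ * z) = p z
  by_cases hz : p z = 1
  · by_contra hne
    rw [hz] at hne
    have := up _ hne
    rw [mul_inv_cancel_left] at this
    exact hne (this ▸ hz)
  · obtain ⟨t, ht, hzt⟩ := P_ne_one hz
    have hpz : p z = p t := P_congr_left _ h hzt
    obtain ⟨s, hs, h1, h2⟩ := bwd t ht (hpz ▸ hz)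
    rw [hpz, ← h2]
    apply P_congr_left
    rw [← hnc]
    have := Subgroup.mul_mem _ hzt (Subgroup.inv_mem _ (key s hs t ht h1))
    convert this using 1
    group



noncomputable def LL (N : Subgroup B) (M : Subgroup A) : Subgroup (RWreath A B) where
  carrier := {x | x.left ∈ J N M ∧ x.right ∈ N}
  one_mem' := ⟨Subgroup.one_mem _, Subgroup.one_mem _⟩
  mul_mem' := by
    rintro x y ⟨h1, h2⟩ ⟨h3, h4⟩
    refine ⟨?_, N.mul_mem h2 h4⟩
    rw [SemidirectProduct.mul_left]
    have := Subgroup.mul_mem _ (act_div_mem_J M h2 y.left) h3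
    rw [div_mul_cancel] at this
    exact Subgroup.mul_mem _ h1 this
  inv_mem' := by
    rintro x ⟨h1, h2⟩
    refine ⟨?_, N.inv_mem h2⟩
    rw [SemidirectProduct.inv_left]
    have := Subgroup.mul_mem _ (act_div_mem_J M (N.inv_mem h2) x.left⁻¹) (Subgroup.inv_mem _ h1)
    rwa [div_mul_cancel] at this

lemma mem_LL_iff {N : Subgroup B} {M : Subgroup A} {x : RWreath A B} :
    x ∈ LL N M ↔ x.left ∈ J N M ∧ x.right ∈ N := Iff.rfl

lemma mem_LL_div {N : Subgroup B} {M : Subgroup A} (x y : RWreath A B) :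
    x * y⁻¹ ∈ LL N M ↔ x.left / y.left ∈ J N M ∧ x.right * y.right⁻¹ ∈ N := by
  rw [mem_LL_iff]
  refine and_congr_left (c := x.right * y.right⁻¹ ∈ N) ?_
  intro h
  have hr : x.right * y.right⁻¹ ∈ N := h
  have e : (x * y⁻¹).left = (x.left / y.left) *
      (wreathAction A B (x.right * y.right⁻¹) y.left / y.left)⁻¹ := by
    rw [SemidirectProduct.mul_left, SemidirectProduct.inv_left, ← MulAut.mul_apply, ← map_mul,
      map_inv]
    rw [inv_div, div_mul_div_cancel, div_eq_mul_inv]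
  rw [e, Subgroup.mul_mem_cancel_right]
  exact Subgroup.inv_mem _ (act_div_mem_J M hr y.left)

lemma LL_normal (N : Subgroup B) [hN : N.Normal] (M : Subgroup A) : (LL N M).Normal := by
  constructor
  intro l hl x
  rw [mem_LL_div]
  rw [mem_LL_iff] at hl
  constructor
  · rw [SemidirectProduct.mul_left, mul_div_cancel_left]
    exact act_mem_J (fun d => (hN.mem_comm_iff).trans (by simp)) hl.1
  · exact hN.conj_mem _ hl.2 _

lemma J_coC (V : ECPseudoVariety.{u}) {N : Subgroup B} (hN : N ∈ V.coC B) {M : Subgroup A}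
    (hM : M ∈ V.coC A) : J N M ∈ V.coC (WreathBase A B) := by
  have hn := hN.1
  have := V.finite _ hN.2
  let e : B → (WreathBase A B →* A) := fun x => (Pi.evalMonoidHom (fun _ : B => A) x).comp (P N)
  obtain ⟨L, hL, -, hq⟩ := exists_fin V (Set.univ : Set (B ⧸ N)) Set.finite_univ
    (fun q L => L ≤ M.comap (e q.out)) (fun i N N' h h' => h.trans h')
    (fun q _ => ⟨_, comap_coC V _ hM, le_rfl⟩) (M.comap (e 1)) (comap_coC V _ hM)
  refine up_coC V hL ?_ inferInstance
  intro φ hφ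
  rw [mem_J]
  intro z
  have h1 : P N φ (QuotientGroup.mk z : B ⧸ N).out ∈ M := hq (QuotientGroup.mk z) trivial hφ
  rwa [P_congr_left N φ] at h1
  have : z⁻¹ * (QuotientGroup.mk z : B ⧸ N).out ∈ N := by
    rw [← QuotientGroup.eq]; exact (Quotient.out_eq' _).symm
  have h3 := hn.conj_mem _ this z
  convert h3 using 1
  group

lemma LL_coC (V : ECPseudoVariety.{u}) {N : Subgroup B} (hN : N ∈ V.coC B) {M : Subgroup A}
    (hM : M ∈ V.coC A) : LL N M ∈ V.coC (RWreath A B) := by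
  have hn := hN.1
  refine ext_coC V (SemidirectProduct.inl : WreathBase A B →* RWreath A B) (LL N M)
    (N.comap SemidirectProduct.rightHom) (LL_normal N M) (comap_coC V _ hN) ?_ ?_ ?_ ?_
  · intro x hx
    exact hx.2
  · intro w
    simp
  · intro p hp
    refine ⟨p.left, ?_⟩
    have : ((SemidirectProduct.inl p.left)⁻¹ * p : RWreath A B) =
        SemidirectProduct.inr p.right := by
      rw [inv_mul_eq_iff_eq_mul, SemidirectProduct.inl_left_mul_inr_right]
    rw [this, mem_LL_iff]
    refine ⟨?_, by simpa using hp⟩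
    simp
  · have e : (LL N M).comap (SemidirectProduct.inl : WreathBase A B →* RWreath A B) = J N M := by
      ext w
      rw [Subgroup.mem_comap, mem_LL_iff]
      simp
    rw [e]
    exact J_coC V hN hM

lemma LL_mono {N N' : Subgroup B} {M M' : Subgroup A} (h : N ≤ N') (h' : M ≤ M') :
    LL N M ≤ LL N' M' := fun _ hx => ⟨J_mono h h' hx.1, h hx.2⟩

lemma exists_LL_le (V : ECPseudoVariety.{u}) (K : Subgroup (RWreath A B))
    (hK : K ∈ V.coC (RWreath A B)) :
    ∃ N ∈ V.coC B, ∃ M ∈ V.coC A, LL N M ≤ K := by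
  have hn := hK.1
  refine ⟨K.comap SemidirectProduct.inr, comap_coC V _ hK,
    K.comap (SemidirectProduct.inl.comp (sgl 1)), comap_coC V _ hK, ?_⟩
  have hJ : J (K.comap SemidirectProduct.inr) (K.comap (SemidirectProduct.inl.comp (sgl 1)))
      ≤ K.comap (SemidirectProduct.inl : WreathBase A B →* RWreath A B) := by
    apply J_le
    · intro x a ha
      have h1 : (SemidirectProduct.inl (sgl (1 : B) a) : RWreath A B) ∈ K := ha
      have := hn.conj_mem _ h1 (SemidirectProduct.inr x)
      rw [← map_inv, ← SemidirectProduct.inl_aut, act_sgl, mul_one] at this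
      exact this
    · intro x d hd a
      have h1 : (SemidirectProduct.inr d : RWreath A B) ∈ K := hd
      show SemidirectProduct.inl _ ∈ K
      rw [map_div, ← act_sgl, SemidirectProduct.inl_aut, div_eq_mul_inv, map_inv, mul_assoc,
        mul_assoc]
      apply K.mul_mem h1
      rw [← mul_assoc]
      exact hn.conj_mem _ (K.inv_mem h1) _
  intro x hx
  rw [← SemidirectProduct.inl_left_mul_inr_right x]
  exact K.mul_mem (hJ hx.1) hx.2

theorem main_comm (V : ECPseudoVariety.{u}) (hresA : V.Residually A) (hB : V.HCS B)
    (hcyc : ∀ x : B, V.CSeparable ((Subgroup.zpowers x : Subgroup B) : Set B))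
    (h : WreathBase A B) (b : B) :
    V.SatisfiesCCAt (SemidirectProduct.inl h * SemidirectProduct.inr b : RWreath A B) := by
  intro K hK
  obtain ⟨N, hN, M, hM, hNMK⟩ := exists_LL_le V K hK
  obtain ⟨N2, hN2, hN2N, n, hn, hord, horb⟩ := orb_good V hcyc b N hN M hM
  obtain ⟨N', hN', hN'N2, M', hM', hM'M, hsel⟩ := main_sel V hresA hB hcyc h b N2 hN2 M hM
  have i1 := hN.1
  have i2 := hN2.1
  have i3 := hN'.1
  have f2 := V.finite _ hN2.2
  have hLn := LL_normal N' M'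
  refine ⟨LL N' M', LL_coC V hN' hM', (LL_mono (hN'N2.trans hN2N) hM'M).trans hNMK, hLn, ?_⟩
  intro q hq
  obtain ⟨x, rfl⟩ := QuotientGroup.mk_surjective q
  refine ⟨x, ?_, rfl⟩
  set g : RWreath A B := SemidirectProduct.inl h * SemidirectProduct.inr b with hg
  have hgl : g.left = h := by simp [hg]
  have hgr : g.right = b := by simp [hg]
  have hcomm : (QuotientGroup.mk (x * g) : RWreath A B ⧸ LL N' M') = QuotientGroup.mk (g * x) :=
    (Subgroup.mem_centralizer_iff.mp hq _ rfl).symm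
  have hmem : (x * g) * (g * x)⁻¹ ∈ LL N' M' := by
    rw [← QuotientGroup.eq_one_iff]
    rw [QuotientGroup.mk_mul, QuotientGroup.mk_inv, hcomm, mul_inv_cancel]
  rw [mem_LL_div] at hmem
  simp only [SemidirectProduct.mul_left, SemidirectProduct.mul_right, hgl, hgr] at hmem
  set f := x.left
  set c := x.right
  obtain ⟨hm1, hm2⟩ := hmem
  -- the class of h
  have hJD : wreathAction A B c h / h ∈ J (Subgroup.zpowers b ⊔ N') M' := by
    have h1 := J_mono (le_sup_right : N' ≤ Subgroup.zpowers b ⊔ N') le_rfl hm1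
    have h2 := act_div_mem_J (D := Subgroup.zpowers b ⊔ N') M'
      ((le_sup_left : Subgroup.zpowers b ≤ _) (Subgroup.mem_zpowers b)) f
    have := Subgroup.mul_mem _ h1 h2
    convert this using 1
    rw [div_mul_div_comm, div_eq_div_iff_mul_eq_mul]
    simp only [mul_comm, mul_left_comm, mul_assoc]
  obtain ⟨c1, hc1, hc1c, hc1J⟩ := hsel c hm2 hJD
  obtain ⟨f1, hf1⟩ := exists_cobound b _ hc1J
  have hcc1 : c * c1⁻¹ ∈ N2 := i2.mem_comm hc1c
  have hφ : wreathAction A B b (f / f1) / (f / f1) ∈ J N2 M := by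
    have h1 := J_mono hN'N2 hM'M hm1
    have h2 := act_div_mem_J M hcc1 (wreathAction A B c1 h)
    rw [← MulAut.mul_apply, ← map_mul, inv_mul_cancel_right] at h2
    have := Subgroup.mul_mem _ h2 (Subgroup.inv_mem _ h1)
    convert this using 1
    have e1 : wreathAction A B b f1 = wreathAction A B c1 h / h * f1 := by
      rw [← hf1, div_mul_cancel]
    rw [map_div, e1]
    simp only [div_eq_mul_inv, mul_inv_rev, inv_inv]
    generalize wreathAction A B c1 h = X
    generalize wreathAction A B c h = Y
    generalize wreathAction A B b f = Z
    have e2 : Y * X⁻¹ * (h * Z * (Y⁻¹ * f⁻¹)) = (Y * Y⁻¹) * (X⁻¹ * (h * Z * f⁻¹)) := by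
      simp only [mul_comm, mul_left_comm, mul_assoc]
    have e3 : Z * (f1⁻¹ * (h * X⁻¹)) * (f1 * f⁻¹) = (f1 * f1⁻¹) * (X⁻¹ * (h * Z * f⁻¹)) := by
      simp only [mul_comm, mul_left_comm, mul_assoc]
    rw [e2, mul_inv_cancel, one_mul]
    refine Eq.trans ?_ (e3.trans ?_)
    · simp only [mul_comm, mul_left_comm, mul_assoc]
    · rw [mul_inv_cancel, one_mul]
  let F0 : Subgroup (WreathBase A B) :=
    (wreathAction A B b).toMonoidHom.eqLocus (MonoidHom.id _)
  have hF : f / f1 ∈ F0 ⊔ J N M := by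
    refine orbit_decomp b N2 n hn hord M _ hφ _ ((J_mono hN2N le_rfl).trans le_sup_right) ?_
    intro y a
    rcases horb y a with h1 | h1
    · exact (le_sup_left : F0 ≤ _) h1
    · exact (le_sup_right : J N M ≤ _) h1
  obtain ⟨w, hw, v, hv, hwv⟩ := Subgroup.mem_sup.mp hF
  have hw' : wreathAction A B b w = w := hw
  let z : RWreath A B := ⟨f1 * w, c1⟩
  refine ⟨z, ?_, z⁻¹ * x, ?_, by simp⟩
  · apply Subgroup.mem_centralizer_iff.mpr
    rintro _ rfl
    apply SemidirectProduct.ext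
    · simp only [SemidirectProduct.mul_left, hgl, hgr, z]
      rw [map_mul, hw']
      have e1 : wreathAction A B b f1 = wreathAction A B c1 h / h * f1 := by
        rw [← hf1, div_mul_cancel]
      rw [e1, ← mul_assoc, ← mul_assoc, mul_div_cancel]
      simp only [mul_comm, mul_left_comm, mul_assoc]
    · simp only [SemidirectProduct.mul_right, hgr, z]
      exact hc1.symm
  · apply hNMK
    have hLn' := LL_normal N M
    apply hLn'.mem_comm
    rw [mem_LL_div]
    refine ⟨?_, hN2N hcc1⟩
    show f / (f1 * w) ∈ J N M
    rw [← div_div, ← hwv, mul_div_cancel_left]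
    exact hv

end main
end CCproof

/-- Under the hypotheses of the infinite-acting-group case, every
element `hb` with `h ≠ 1` in the base group and `b ≠ 1` in `B` satisfies the
`𝒞`-centralizer condition in `A ≀ B`. -/
theorem general_elements_CC (V : ECPseudoVariety.{u}) (A B : Type u) [Group A] [Group B]
    (habA : ∀ x y : A, x * y = y * x) (hresA : V.Residually A)
    [Infinite B] (hB : V.HCS B)
    (hcyc : ∀ x : B, V.CSeparable ((Subgroup.zpowers x : Subgroup B) : Set B))
    (h : WreathBase A B) (hh : h ≠ 1) (b : B) (hb : b ≠ 1) :
    V.SatisfiesCCAt (SemidirectProduct.inl h * SemidirectProduct.inr b : RWreath A B) := by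
  letI : CommGroup A := { ‹Group A› with mul_comm := habA }
  exact CCproof.main_comm V hresA hB hcyc h b
end

section
/- Let G = A ≀ B with A abelian and let b ∈ B have infinite order. (i) The centralizer of b in G equals C_B(b), i.e., every element of G commuting with b lies in the subgroup B and commutes with b there. (ii) If furthermore f is a nontrivial element of the base group such that fb is reduced, then the canonical projection G → B restricts to an isomorphism from C_G(fb) onto C_B(f,b); in particular, C_G(fb) is virtually cyclic. -/
open Pointwise

universe u

section Helpers

open Function

noncomputable def cprod {A B : Type u} [CommGroup A] [Group B] (b : B) (F : B → A) (x : B) : A :=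
  ∏ᶠ k : ℤ, F (b ^ k * x)

lemma orbit_inj {B : Type u} [Group B] {b : B} (hb : ¬ IsOfFinOrder b) (x : B) :
    Function.Injective (fun k : ℤ => b ^ k * x) := by
  intro i j h
  exact injective_zpow_iff_not_isOfFinOrder.mpr hb (mul_right_cancel h)

lemma orbit_fin {A B : Type u} [CommGroup A] [Group B] {b : B} (hb : ¬ IsOfFinOrder b)
    {F : B → A} (hF : (mulSupport F).Finite) (x : B) :
    (mulSupport fun k : ℤ => F (b ^ k * x)).Finite :=
  Set.Finite.preimage (f := fun k : ℤ => b ^ k * x) (orbit_inj hb x).injOn hF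

lemma cprod_zpow {A B : Type u} [CommGroup A] [Group B] (b : B) (F : B → A) (n : ℤ) (x : B) :
    cprod b F (b ^ n * x) = cprod b F x := by
  unfold cprod
  rw [← finprod_comp_equiv (Equiv.addRight n) (f := fun k : ℤ => F (b ^ k * x))]
  refine finprod_congr fun k => ?_
  simp [zpow_add, mul_assoc]

lemma inv_shift_trivial {A B : Type u} [Group A] [Group B] {b : B} (hb : ¬ IsOfFinOrder b)
    {h : B → A} (hh : (mulSupport h).Finite) (H : ∀ x, h (b⁻¹ * x) = h x) (x : B) : h x = 1 := by
  by_contra hx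
  have key : ∀ n : ℕ, h (b ^ (-(n:ℤ)) * x) = h x := by
    intro n
    induction n with
    | zero => simp
    | succ n ih =>
      rw [← ih, ← H (b ^ (-(n:ℤ)) * x), ← mul_assoc, ← zpow_neg_one, ← zpow_add]
      congr 3; push_cast; ring
  have hinj : Function.Injective (fun n : ℕ => b ^ (-(n:ℤ)) * x) := by
    intro i j hij
    have := orbit_inj hb x hij
    simpa using this
  refine Set.infinite_of_injective_forall_mem (s := mulSupport h) hinj ?_ hh
  intro n
  show h _ ≠ 1
  rw [key]; exact hx

lemma cprod_of_ne {A B : Type u} [CommGroup A] [Group B] {b : B} (hb : ¬ IsOfFinOrder b)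
    {f : WreathBase A B} (hr : IsReducedPair f b) {s : B} (hs : (f : B → A) s ≠ 1) :
    cprod b (f : B → A) s = (f : B → A) s := by
  unfold cprod
  rw [finprod_eq_single _ 0]
  · simp
  · intro k hk
    by_contra hne
    have := hr s hs _ hne (by simp)
    apply hk
    apply orbit_inj hb s
    simpa using this.symm

lemma exists_of_cprod_ne {A B : Type u} [CommGroup A] [Group B] {b : B} (hb : ¬ IsOfFinOrder b)
    {f : WreathBase A B} (hr : IsReducedPair f b) {x : B} (hx : cprod b (f : B → A) x ≠ 1) :
    ∃ k : ℤ, (f : B → A) (b ^ k * x) = cprod b (f : B → A) x := by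
  by_contra hcon
  apply hx
  unfold cprod
  apply finprod_eq_one_of_forall_eq_one
  intro k
  by_contra hk
  exact hcon ⟨k, by rw [← cprod_of_ne hb hr hk, cprod_zpow]⟩

lemma exists_primitive {A B : Type u} [CommGroup A] [Group B] {b : B} (hb : ¬ IsOfFinOrder b)
    {F : B → A} (hF : (mulSupport F).Finite) (hP : ∀ x, cprod b F x = 1) :
    ∃ h : B → A, (mulSupport h).Finite ∧ ∀ x, h x = F x * h (b⁻¹ * x) := by
  refine ⟨fun x => ∏ᶠ j ∈ Set.Iic (0:ℤ), F (b ^ j * x), ?_, ?_⟩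
  · have hbd : ∀ s : B, ∃ c : ℤ, ∀ j : ℤ, F (b ^ j * s) ≠ 1 → j ≤ c := by
      intro s
      obtain ⟨c, hc⟩ := (orbit_fin hb hF s).bddAbove
      exact ⟨c, fun j hj => hc hj⟩
    choose c hc using hbd
    refine Set.Finite.subset (hF.biUnion fun s _ =>
      (Set.finite_Icc (0:ℤ) (c s)).image fun k => b ^ k * s) ?_
    intro x hx
    obtain ⟨j, hj, hne⟩ := exists_ne_one_of_finprod_mem_ne_one hx
    simp only [Set.mem_iUnion]
    refine ⟨b ^ j * x, hne, -j, ⟨by simpa using hj, ?_⟩, by simp⟩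
    by_contra hlt
    apply hx
    show ∏ᶠ j ∈ Set.Iic (0:ℤ), F (b ^ j * x) = 1
    rw [finprod_mem_inter_mulSupport_eq' _ _ Set.univ, finprod_mem_univ]
    · exact hP x
    · intro i hi
      simp only [Set.mem_Iic, Set.mem_univ, iff_true]
      have := hc (b ^ j * x) (i - j) (by rw [← mul_assoc, ← zpow_add]; simpa using hi)
      omega
  · intro x
    have h1 : Set.Iic (0:ℤ) = insert 0 (Set.Iic (-1)) := by
      ext i; simp only [Set.mem_Iic, Set.mem_insert_iff]; omega
    have h2 : ∏ᶠ j ∈ Set.Iic (0:ℤ), F (b ^ j * (b⁻¹ * x)) =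
        ∏ᶠ j ∈ Set.Iic (-1:ℤ), F (b ^ j * x) := by
      refine finprod_mem_eq_of_bijOn (fun j => j - 1) ⟨?_, ?_, ?_⟩ ?_
      · intro i hi; simp only [Set.mem_Iic] at *; omega
      · intro i _ j _ hij; simp only at hij; omega
      · intro i hi
        exact ⟨i + 1, by simp only [Set.mem_Iic] at *; omega, by simp⟩
      · intro i _
        rw [zpow_sub_one, mul_assoc]
    show ∏ᶠ j ∈ Set.Iic (0:ℤ), F (b ^ j * x) = F x * ∏ᶠ j ∈ Set.Iic (0:ℤ), F (b ^ j * (b⁻¹ * x))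
    rw [h2, h1, finprod_mem_insert' _ (by simp) ((orbit_fin hb hF x).inter_of_right _)]
    simp

lemma cprod_mul {A B : Type u} [CommGroup A] [Group B] {b : B} (hb : ¬ IsOfFinOrder b)
    {F G : B → A} (hF : (mulSupport F).Finite) (hG : (mulSupport G).Finite) (x : B) :
    cprod b (fun y => F y * G y) x = cprod b F x * cprod b G x :=
  finprod_mul_distrib (orbit_fin hb hF x) (orbit_fin hb hG x)

lemma cprod_comp {A B : Type u} [CommGroup A] [Group B] {b c : B} (hc : c * b = b * c)
    (F : B → A) (x : B) :
    cprod b (fun y => F (c * y)) x = cprod b F (c * x) := by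
  unfold cprod
  refine finprod_congr fun k => ?_
  have : Commute c (b ^ k) := (show Commute c b from hc).zpow_right k
  show F (c * (b ^ k * x)) = F (b ^ k * (c * x))
  rw [← mul_assoc, this.eq, mul_assoc]

lemma shift_fin {A B : Type u} [Group A] [Group B] (c : B)
    {F : B → A} (hF : (mulSupport F).Finite) : (mulSupport fun y => F (c * y)).Finite :=
  Set.Finite.preimage (f := fun y => c * y) (mul_right_injective c).injOn hF

lemma rcoset_eq_iff {B : Type u} [Group B] {b x y : B} :
    rcoset b x = rcoset b y ↔ ∃ k : ℤ, x = b ^ k * y := by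
  constructor
  · intro h
    have : x ∈ rcoset b y := by rw [← h]; simp [rcoset]
    obtain ⟨k, hk⟩ := Subgroup.mem_zpowers_iff.mp this
    exact ⟨k, by rw [hk]; simp⟩
  · rintro ⟨k, rfl⟩
    ext z
    simp only [rcoset, Set.mem_setOf_eq, mul_inv_rev, ← mul_assoc]
    exact Subgroup.mul_mem_cancel_right _
      (Subgroup.inv_mem _ (Subgroup.zpow_mem _ (Subgroup.mem_zpowers b) k))

lemma cprod_eq_of_mem {A B : Type u} [CommGroup A] [Group B] {b : B} (hb : ¬ IsOfFinOrder b)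
    {f : WreathBase A B} (hr : IsReducedPair f b) {c : B} (hc : c ∈ CBsubgroup f b) {x : B}
    (hx : cprod b (f : B → A) x ≠ 1) :
    cprod b (f : B → A) (c * x) = cprod b (f : B → A) x := by
  obtain ⟨hc1, hc2⟩ := hc
  have hcb := Subgroup.mem_centralizer_singleton_iff.mp hc1
  obtain ⟨k, hk⟩ := exists_of_cprod_ne hb hr hx
  have hmem : rcoset b (c * (b ^ k * x)) ∈
      rcoset b '' ((f : B → A) ⁻¹' {cprod b (f : B → A) x}) := by
    rw [← hc2 _ hx ⟨_, hk⟩]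
    exact ⟨_, hk, rfl⟩
  obtain ⟨t, ht, hte⟩ := hmem
  obtain ⟨m, hm⟩ := rcoset_eq_iff.mp hte.symm
  have ht' : (f : B → A) t = cprod b (f : B → A) x := ht
  have hcom : Commute c (b ^ k) := (show Commute c b from hcb).zpow_right k
  rw [← cprod_zpow b _ k (c * x), ← mul_assoc, ← hcom.eq, mul_assoc, hm, cprod_zpow,
    cprod_of_ne hb hr (by rw [ht']; exact hx), ht']

lemma mem_CB_iff {A B : Type u} [CommGroup A] [Group B] {b : B} (hb : ¬ IsOfFinOrder b)
    {f : WreathBase A B} (hr : IsReducedPair f b) (c : B) :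
    c ∈ CBsubgroup f b ↔ c * b = b * c ∧
      ∀ x, cprod b (f : B → A) (c⁻¹ * x) = cprod b (f : B → A) x := by
  constructor
  · intro hc
    refine ⟨Subgroup.mem_centralizer_singleton_iff.mp hc.1, fun x => ?_⟩
    by_cases hx : cprod b (f : B → A) x = 1
    · by_contra hne
      rw [hx] at hne
      have := cprod_eq_of_mem hb hr hc hne
      rw [mul_inv_cancel_left] at this
      exact hne (this ▸ hx)
    · exact cprod_eq_of_mem hb hr (Subgroup.inv_mem _ hc) hx
  · rintro ⟨hcb, hP⟩
    refine ⟨Subgroup.mem_centralizer_singleton_iff.mpr hcb, fun a ha _ => ?_⟩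
    ext X
    constructor
    · rintro ⟨s, hs, rfl⟩
      have hs' : (f : B → A) s = a := hs
      have h1 : cprod b (f : B → A) (c * s) = a := by
        rw [← hP, inv_mul_cancel_left, cprod_of_ne hb hr (by rw [hs']; exact ha), hs']
      obtain ⟨k, hk⟩ := exists_of_cprod_ne hb hr (x := c * s) (by rw [h1]; exact ha)
      exact ⟨_, hk.trans h1, rcoset_eq_iff.mpr ⟨k, rfl⟩⟩
    · rintro ⟨s, hs, rfl⟩
      have hs' : (f : B → A) s = a := hs
      have h1 : cprod b (f : B → A) (c⁻¹ * s) = a := by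
        rw [hP, cprod_of_ne hb hr (by rw [hs']; exact ha), hs']
      obtain ⟨k, hk⟩ := exists_of_cprod_ne hb hr (x := c⁻¹ * s) (by rw [h1]; exact ha)
      refine ⟨_, hk.trans h1, rcoset_eq_iff.mpr ⟨k, ?_⟩⟩
      have hcom : Commute c (b ^ k) := (show Commute c b from hcb).zpow_right k
      rw [← mul_assoc, hcom.eq, mul_assoc, mul_inv_cancel_left]

lemma mem_cent_iff {A B : Type u} [Group A] [Group B] (f : WreathBase A B) (b : B)
    (z : RWreath A B) :
    z ∈ Subgroup.centralizer
      ({SemidirectProduct.inl f * SemidirectProduct.inr b} : Set (RWreath A B)) ↔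
    z.right * b = b * z.right ∧ ∀ x, (z.left : B → A) x * (f : B → A) (z.right⁻¹ * x) =
      (f : B → A) x * (z.left : B → A) (b⁻¹ * x) := by
  rw [Subgroup.mem_centralizer_singleton_iff, ← SemidirectProduct.mk_eq_inl_mul_inr,
    SemidirectProduct.ext_iff, and_comm]
  refine and_congr Iff.rfl ?_
  rw [Subtype.ext_iff, funext_iff]
  rfl

lemma cent_inj {A B : Type u} [CommGroup A] [Group B] {b : B} (hb : ¬ IsOfFinOrder b)
    {f : WreathBase A B} {z w : RWreath A B}
    (hz : z ∈ Subgroup.centralizer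
      ({SemidirectProduct.inl f * SemidirectProduct.inr b} : Set (RWreath A B)))
    (hw : w ∈ Subgroup.centralizer
      ({SemidirectProduct.inl f * SemidirectProduct.inr b} : Set (RWreath A B)))
    (h : z.right = w.right) : z = w := by
  have hz2 := ((mem_cent_iff f b z).mp hz).2
  have hw2 := ((mem_cent_iff f b w).mp hw).2
  refine SemidirectProduct.ext (Subtype.ext (funext fun x => ?_)) h
  have hfin := (z.left / w.left).2
  have := inv_shift_trivial hb hfin (fun x => ?_) x
  · exact div_eq_one.mp this
  · show (z.left : B → A) (b⁻¹ * x) / (w.left : B → A) (b⁻¹ * x) =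
      (z.left : B → A) x / (w.left : B → A) x
    have e1 := hz2 x
    have e2 := hw2 x
    rw [h] at e1
    have e1' := eq_inv_mul_of_mul_eq e1.symm
    have e2' := eq_inv_mul_of_mul_eq e2.symm
    rw [e1', e2', mul_div_mul_left_eq_div, mul_div_mul_right_eq_div]

theorem main_comm (A B : Type u) [CommGroup A] [Group B]
    (b : B) (hb : ¬ IsOfFinOrder b) :
    (Subgroup.centralizer ({SemidirectProduct.inr b} : Set (RWreath A B)) =
      Subgroup.map SemidirectProduct.inr (Subgroup.centralizer {b})) ∧
    ∀ f : WreathBase A B, f ≠ 1 → IsReducedPair f b →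
      Set.BijOn (⇑(SemidirectProduct.rightHom : RWreath A B →* B))
        ((Subgroup.centralizer
          ({SemidirectProduct.inl f * SemidirectProduct.inr b} : Set (RWreath A B)) :
            Subgroup (RWreath A B)) : Set (RWreath A B))
        ((CBsubgroup f b : Subgroup B) : Set B) ∧
      ∃ K : Subgroup ↥(Subgroup.centralizer
          ({SemidirectProduct.inl f * SemidirectProduct.inr b} : Set (RWreath A B))),
        K.FiniteIndex ∧ IsCyclic ↥K := by
  constructor
  · have h1 : (SemidirectProduct.inr b : RWreath A B) =
        SemidirectProduct.inl 1 * SemidirectProduct.inr b := by simp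
    ext z
    constructor
    · intro hz
      rw [h1] at hz
      have hz1 := ((mem_cent_iff 1 b z).mp hz).1
      refine ⟨z.right, Subgroup.mem_centralizer_singleton_iff.mpr hz1, ?_⟩
      refine cent_inj hb (f := 1) ?_ hz (by simp)
      rw [mem_cent_iff]
      refine ⟨by simpa using hz1, fun x => by simp⟩
    · rintro ⟨c, hc, rfl⟩
      rw [Subgroup.mem_centralizer_singleton_iff, ← map_mul, ← map_mul,
        Subgroup.mem_centralizer_singleton_iff.mp hc]
  · intro f hf hr
    have hmaps : ∀ z : RWreath A B, z ∈ Subgroup.centralizer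
        ({SemidirectProduct.inl f * SemidirectProduct.inr b} : Set (RWreath A B)) →
        z.right ∈ CBsubgroup f b := by
      intro z hz
      obtain ⟨h1, h2⟩ := (mem_cent_iff f b z).mp hz
      rw [mem_CB_iff hb hr]
      refine ⟨h1, fun x => ?_⟩
      have h1' : z.right⁻¹ * b = b * z.right⁻¹ :=
        ((show Commute z.right b from h1).inv_left).eq
      have e : cprod b (fun y => (z.left : B → A) y * (f : B → A) (z.right⁻¹ * y)) x =
          cprod b (fun y => (f : B → A) y * (z.left : B → A) (b⁻¹ * y)) x := by
        congr 1; funext y; exact h2 y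
      rw [cprod_mul hb z.left.2 (shift_fin _ f.2), cprod_mul hb f.2 (shift_fin _ z.left.2),
        cprod_comp h1', cprod_comp (by simp), ← zpow_neg_one b, cprod_zpow, mul_comm] at e
      exact mul_right_cancel e
    refine ⟨⟨hmaps, fun z hz w hw h => cent_inj hb hz hw h, ?_⟩, ?_⟩
    · intro c hc
      obtain ⟨h1, h2⟩ := (mem_CB_iff hb hr c).mp hc
      have h1' : c⁻¹ * b = b * c⁻¹ := ((show Commute c b from h1).inv_left).eq
      have hinv : (mulSupport fun y => ((f : B → A) (c⁻¹ * y))⁻¹).Finite := by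
        refine (shift_fin c⁻¹ f.2).subset fun y hy => ?_
        simpa [Function.mem_mulSupport] using hy
      have hFin : (mulSupport fun y => (f : B → A) y * ((f : B → A) (c⁻¹ * y))⁻¹).Finite :=
        (f.2.union hinv).subset (Function.mulSupport_mul _ _)
      obtain ⟨h, hh, hh2⟩ := exists_primitive hb hFin (fun x => by
        rw [cprod_mul hb f.2 hinv, cprod_comp h1' (fun y => ((f : B → A) y)⁻¹)]
        have : ∀ y, cprod b (fun y => ((f : B → A) y)⁻¹) y = (cprod b (f : B → A) y)⁻¹ :=
          fun y => finprod_inv_distrib _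
        rw [this, h2, mul_inv_cancel])
      refine ⟨⟨⟨h, hh⟩, c⟩, (mem_cent_iff f b _).mpr ⟨h1, fun x => ?_⟩, rfl⟩
      show h x * (f : B → A) (c⁻¹ * x) = (f : B → A) x * h (b⁻¹ * x)
      rw [hh2 x]
      simp only [mul_assoc, mul_comm, mul_left_comm]
      simp
    · obtain ⟨s, hs⟩ : ∃ s, (f : B → A) s ≠ 1 := by
        by_contra hcon
        push Not at hcon
        exact hf (Subtype.ext (funext hcon))
      set Z := Subgroup.centralizer
        ({SemidirectProduct.inl f * SemidirectProduct.inr b} : Set (RWreath A B)) with hZ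
      let g : Z := ⟨SemidirectProduct.inl f * SemidirectProduct.inr b,
        Subgroup.mem_centralizer_singleton_iff.mpr rfl⟩
      have hgr : ∀ k : ℤ, ((g ^ k : Z) : RWreath A B).right = b ^ k := by
        intro k
        show SemidirectProduct.rightHom ((g ^ k : Z) : RWreath A B) = b ^ k
        rw [Subgroup.coe_zpow, map_zpow]
        simp [g]
      refine ⟨Subgroup.zpowers g, ?_, inferInstance⟩
      have hfinset : (rcoset b '' ((f : B → A) ⁻¹' {(f : B → A) s})).Finite := by
        refine Set.Finite.image _ (f.2.subset ?_)
        intro t ht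
        show (f : B → A) t ≠ 1
        rw [show (f : B → A) t = (f : B → A) s from ht]
        exact hs
      have hmem : ∀ z : Z, rcoset b ((z : RWreath A B).right * s) ∈
          rcoset b '' ((f : B → A) ⁻¹' {(f : B → A) s}) := by
        intro z
        rw [← (hmaps z z.2).2 _ hs ⟨s, rfl⟩]
        exact ⟨s, rfl, rfl⟩
      haveI := hfinset.to_subtype
      have hinj : Function.Injective (fun q : Z ⧸ Subgroup.zpowers g =>
          (⟨_, hmem (q.out)⁻¹⟩ : ↥(rcoset b '' ((f : B → A) ⁻¹' {(f : B → A) s})))) := by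
        intro q r hqr
        have h0 := congrArg Subtype.val hqr
        obtain ⟨k, hk⟩ := rcoset_eq_iff.mp h0
        rw [← mul_assoc] at hk
        have hk' := mul_right_cancel hk
        have : (q.out)⁻¹ = g ^ k * (r.out)⁻¹ := by
          apply Subtype.ext
          refine cent_inj hb (q.out⁻¹).2 (g ^ k * (r.out)⁻¹).2 ?_
          rw [hk', Subgroup.coe_mul, SemidirectProduct.mul_right, hgr]
        rw [← QuotientGroup.out_eq' q, ← QuotientGroup.out_eq' r, QuotientGroup.eq, this]
        simp
      haveI := Finite.of_injective _ hinj
      exact Subgroup.finiteIndex_of_finite_quotient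

end Helpers

/-- For `A` abelian and `b ∈ B` of infinite order:
(i) the centralizer of `b` in `G = A ≀ B` is `C_B(b)`;
(ii) if `f ≠ 1` and `fb` is reduced, the canonical projection `G → B` restricts to an
isomorphism (a bijection, being a homomorphism) from `C_G(fb)` onto `C_B(f,b)`; in
particular `C_G(fb)` is virtually cyclic. -/
theorem centralizer_wreath_infinite_order (A B : Type u) [Group A] [Group B]
    (hab : ∀ x y : A, x * y = y * x) (b : B) (hb : ¬ IsOfFinOrder b) :
    (Subgroup.centralizer ({SemidirectProduct.inr b} : Set (RWreath A B)) =
      Subgroup.map SemidirectProduct.inr (Subgroup.centralizer {b})) ∧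
    ∀ f : WreathBase A B, f ≠ 1 → IsReducedPair f b →
      Set.BijOn (⇑(SemidirectProduct.rightHom : RWreath A B →* B))
        ((Subgroup.centralizer
          ({SemidirectProduct.inl f * SemidirectProduct.inr b} : Set (RWreath A B)) :
            Subgroup (RWreath A B)) : Set (RWreath A B))
        ((CBsubgroup f b : Subgroup B) : Set B) ∧
      ∃ K : Subgroup ↥(Subgroup.centralizer
          ({SemidirectProduct.inl f * SemidirectProduct.inr b} : Set (RWreath A B))),
        K.FiniteIndex ∧ IsCyclic ↥K := by
  exact @main_comm A B { (inferInstance : Group A) with mul_comm := hab } _ b hb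
end

section
/- Let 𝒞 be an extension-closed pseudo-variety of finite groups, let A be any group and let B be a group with B ∈ 𝒞. Then every element b ∈ B, viewed as an element of the restricted wreath product G = A ≀ B, satisfies the 𝒞-centralizer condition in G. -/
open Pointwise

universe u

lemma wcc_trivial (V : ECPseudoVariety.{u}) (Q P : Type u) [Group Q] [Group P] [Unique P]
    (hQ : V.mem Q) : V.mem P :=
  V.iso_closed (⊥ : Subgroup Q) P MulEquiv.ofUnique (V.subgroup_closed Q ⊥ hQ)

lemma wcc_finpow (V : ECPseudoVariety.{u}) (Q : Type u) [Group Q]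
    (hQ : V.mem Q) (n : ℕ) : V.mem (Fin n → Q) := by
  induction n with
  | zero => exact wcc_trivial V Q _ hQ
  | succ n ih =>
    refine V.iso_closed (Q × (Fin n → Q)) _ ?_ (V.prod_closed _ _ hQ ih)
    exact
      { Fin.consEquiv (fun _ : Fin (n + 1) => Q) with
        map_mul' := by
          intro x y
          funext i
          refine Fin.cases ?_ (fun j => ?_) i <;> simp [Fin.consEquiv] }

lemma wcc_pow (V : ECPseudoVariety.{u}) (Q B : Type u) [Group Q] [Finite B]
    (hQ : V.mem Q) : V.mem (B → Q) := by
  obtain ⟨n, ⟨e⟩⟩ := Finite.exists_equiv_fin B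
  exact V.iso_closed (Fin n → Q) _ (MulEquiv.arrowCongr e.symm (MulEquiv.refl Q))
    (wcc_finpow V Q hQ n)

lemma wcc_range (V : ECPseudoVariety.{u}) (G H : Type u) [Group G] [Group H]
    (φ : G →* H) (hH : V.mem H) : V.mem (G ⧸ φ.ker) :=
  V.iso_closed _ _ (QuotientGroup.quotientKerEquivRange φ).symm
    (V.subgroup_closed H φ.range hH)

lemma wcc_wreath (V : ECPseudoVariety.{u}) (Q B : Type u) [Group Q] [Group B]
    (hQ : V.mem Q) (hB : V.mem B) : V.mem (RWreath Q B) := by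
  haveI := V.finite B hB
  refine V.extension_closed _ (SemidirectProduct.rightHom : RWreath Q B →* B).ker ?_
    (wcc_range V _ _ _ hB)
  rw [← SemidirectProduct.range_inl_eq_ker_rightHom]
  exact V.iso_closed (WreathBase Q B) _
    (MonoidHom.ofInjective SemidirectProduct.inl_injective)
    (V.subgroup_closed _ _ (wcc_pow V Q B hQ))

/-- functorial map on wreath products -/
def wccMap {A Q : Type u} (B : Type u) [Group A] [Group Q] [Group B] [Finite B] (q : A →* Q) :
    RWreath A B →* RWreath Q B where
  toFun g := ⟨⟨fun x => q ((g.left : B → A) x), Set.toFinite _⟩, g.right⟩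
  map_one' := by
    refine SemidirectProduct.ext ?_ rfl
    apply Subtype.ext
    funext x
    exact map_one q
  map_mul' g h := by
    refine SemidirectProduct.ext ?_ rfl
    apply Subtype.ext
    funext x
    exact map_mul q _ _

def wccPsi (A B : Type u) [Group A] [Group B] [Finite B] : (B → A) →* RWreath A B :=
  SemidirectProduct.inl.comp
    { toFun := fun f => (⟨f, Set.toFinite _⟩ : WreathBase A B)
      map_one' := rfl
      map_mul' := fun _ _ => rfl }

open Classical in
lemma wcc_conj (A B : Type u) [Group A] [Group B] [Finite B] (x : B) (a : A) :
    wccPsi A B (Pi.mulSingle x a) =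
      SemidirectProduct.inr x * wccPsi A B (Pi.mulSingle 1 a) * (SemidirectProduct.inr x)⁻¹ := by
  rw [eq_mul_inv_iff_mul_eq]
  refine SemidirectProduct.ext ?_ ?_
  · apply Subtype.ext
    funext y
    have : (Pi.mulSingle x a : B → A) y = (Pi.mulSingle 1 a : B → A) (x⁻¹ * y) := by
      simp only [Pi.mulSingle_apply, inv_mul_eq_one, eq_comm]
    show (Pi.mulSingle x a : B → A) y * 1 = 1 * (Pi.mulSingle 1 a : B → A) (x⁻¹ * y)
    rw [mul_one, one_mul, this]
  · simp [wccPsi]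

lemma wcc_comm {A B : Type u} [Group A] [Group B] (b : B) (g : RWreath A B) :
    SemidirectProduct.inr b * g = g * SemidirectProduct.inr b ↔
      b * g.right = g.right * b ∧
        ∀ x, (g.left : B → A) (b⁻¹ * x) = (g.left : B → A) x := by
  rw [SemidirectProduct.ext_iff, and_comm, Subtype.ext_iff, funext_iff]
  refine and_congr Iff.rfl (forall_congr' fun x => ?_)
  show 1 * (g.left : B → A) (b⁻¹ * x) = (g.left : B → A) x * 1 ↔ _
  rw [one_mul, mul_one]

/-- If `B ∈ 𝒞`, then every `b ∈ B` satisfies the `𝒞`-centralizer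
condition in `A ≀ B`. -/
theorem acting_elements_CC_of_mem (V : ECPseudoVariety.{u}) (A B : Type u)
    [Group A] [Group B] (hB : V.mem B) (b : B) :
    V.SatisfiesCCAt (SemidirectProduct.inr b : RWreath A B) := by
  classical
  haveI := V.finite B hB
  rintro K ⟨hK, hKm⟩
  let θ : A →* RWreath A B ⧸ K :=
    (QuotientGroup.mk' K).comp ((wccPsi A B).comp (MonoidHom.mulSingle (fun _ : B => A) 1))
  have hθ : ∀ a, a ∈ θ.ker → ∀ x : B, wccPsi A B (Pi.mulSingle x a) ∈ K := by
    intro a ha x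
    rw [wcc_conj]
    exact hK.conj_mem _ ((QuotientGroup.eq_one_iff _).1 ha) _
  let φ := wccMap B (QuotientGroup.mk' θ.ker)
  have hφ : ∀ g, g ∈ φ.ker ↔ g.right = 1 ∧ ∀ x, (g.left : B → A) x ∈ θ.ker := by
    intro g
    rw [MonoidHom.mem_ker, SemidirectProduct.ext_iff, and_comm, Subtype.ext_iff, funext_iff]
    exact and_congr Iff.rfl (forall_congr' fun x => QuotientGroup.eq_one_iff _)
  have hLK : φ.ker ≤ K := by
    intro g hg
    obtain ⟨h1, h2⟩ := (hφ g).1 hg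
    have : (g.left : B → A) ∈ K.comap (wccPsi A B) :=
      Subgroup.pi_mem_of_mulSingle_mem _ fun x => hθ _ (h2 x) x
    have e : g = wccPsi A B (g.left : B → A) := SemidirectProduct.ext rfl h1
    rw [e]; exact this
  refine ⟨φ.ker, ⟨inferInstance, wcc_range V _ _ φ
    (wcc_wreath V _ B (wcc_range V _ _ θ hKm) hB)⟩, hLK, inferInstance, ?_⟩
  intro y hy
  obtain ⟨g, rfl⟩ := QuotientGroup.mk_surjective y
  have hc : (QuotientGroup.mk (SemidirectProduct.inr b * g) : RWreath A B ⧸ φ.ker) =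
      QuotientGroup.mk (g * SemidirectProduct.inr b) :=
    Subgroup.mem_centralizer_iff.mp hy _ rfl
  have hc2 : φ (SemidirectProduct.inr b * g) = φ (g * SemidirectProduct.inr b) := by
    have := QuotientGroup.eq.1 hc
    rwa [MonoidHom.mem_ker, map_mul, map_inv, inv_mul_eq_one] at this
  have hb : φ (SemidirectProduct.inr b) = SemidirectProduct.inr b := by
    refine SemidirectProduct.ext ?_ rfl
    apply Subtype.ext
    funext x
    exact map_one (QuotientGroup.mk' θ.ker)
  rw [map_mul, map_mul, hb, wcc_comm] at hc2
  obtain ⟨hr, hl⟩ := hc2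
  let F : B → A ⧸ θ.ker := fun x => QuotientGroup.mk ((g.left : B → A) x)
  have hl' : ∀ x, F (b⁻¹ * x) = F x := hl
  have hpow : ∀ z ∈ Subgroup.zpowers b, ∀ x, F (z * x) = F x := by
    intro z hz
    rw [Subgroup.zpowers_eq_closure] at hz
    induction hz using Subgroup.closure_induction with
    | mem z h =>
      rw [Set.mem_singleton_iff] at h
      subst h
      intro x
      rw [← hl' (z * x), inv_mul_cancel_left]
    | one => simp
    | mul z w _ _ h1 h2 => intro x; rw [mul_assoc, h1, h2]
    | inv z _ h => intro x; rw [← h (z⁻¹ * x), mul_inv_cancel_left]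
  let f' : B → A := fun x => Quotient.out (F x)
  let g' : RWreath A B := ⟨⟨f', Set.toFinite _⟩, g.right⟩
  have hg' : φ g' = φ g := by
    refine SemidirectProduct.ext ?_ rfl
    apply Subtype.ext
    funext x
    exact Quotient.out_eq (F x)
  have hmem : g'⁻¹ * g ∈ φ.ker := by
    rw [MonoidHom.mem_ker, map_mul, map_inv, hg', inv_mul_cancel]
  refine ⟨g, ⟨g', ?_, g'⁻¹ * g, hLK hmem, by simp⟩, rfl⟩
  refine Subgroup.mem_centralizer_iff.mpr ?_
  rintro _ rfl
  refine ((wcc_comm b g').2 ⟨hr, fun x => ?_⟩)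
  show Quotient.out (F (b⁻¹ * x)) = Quotient.out (F x)
  rw [hl']
end

section
/- Let 𝒞 be an extension-closed pseudo-variety of finite groups, and let A and B be groups such that A is abelian and residually-𝒞 and B is an infinite 𝒞-hereditarily conjugacy separable group each of whose cyclic subgroups is 𝒞-separable in B. Then every element b ∈ B, viewed as an element of G = A ≀ B, satisfies the 𝒞-centralizer condition in G. -/
open Pointwise

universe u

namespace AECC
open ECPseudoVariety

variable {V : ECPseudoVariety.{u}}

lemma mem_of_surj {G H : Type u} [Group G] [Group H] (f : G →* H) (hf : Function.Surjective f)
    {N : Subgroup G} (hN : N ∈ V.coC G) (hle : N ≤ f.ker) : V.mem H := by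
  obtain ⟨hn, hm⟩ := hN
  have hs : Function.Surjective (QuotientGroup.lift N f hle) := by
    intro y
    obtain ⟨x, rfl⟩ := hf y
    exact ⟨(x : G ⧸ N), rfl⟩
  exact V.iso_closed _ _ (QuotientGroup.quotientKerEquivOfSurjective _ hs)
    (V.quotient_closed _ _ hm)

lemma coC_ker {G H : Type u} [Group G] [Group H] (f : G →* H) (hH : V.mem H) :
    f.ker ∈ V.coC G :=
  ⟨inferInstance, V.iso_closed _ _ (QuotientGroup.quotientKerEquivRange f).symm
    (V.subgroup_closed _ _ hH)⟩

lemma coC_comap {G H : Type u} [Group G] [Group H] (f : G →* H) {N : Subgroup H}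
    (hN : N ∈ V.coC H) : N.comap f ∈ V.coC G := by
  obtain ⟨hn, hm⟩ := hN
  have := coC_ker ((QuotientGroup.mk' N).comp f) hm
  rwa [← MonoidHom.comap_ker, QuotientGroup.ker_mk'] at this

lemma coC_mono {G : Type u} [Group G] {N N' : Subgroup G} (hN : N ∈ V.coC G)
    (hn : N'.Normal) (h : N ≤ N') : N' ∈ V.coC G :=
  ⟨hn, mem_of_surj (QuotientGroup.mk' N') (QuotientGroup.mk'_surjective N') hN (by simpa using h)⟩

lemma coC_inf {G : Type u} [Group G] {N N' : Subgroup G} (hN : N ∈ V.coC G)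
    (hN' : N' ∈ V.coC G) : N ⊓ N' ∈ V.coC G := by
  obtain ⟨hn, hm⟩ := hN
  obtain ⟨hn', hm'⟩ := hN'
  have := coC_ker ((QuotientGroup.mk' N).prod (QuotientGroup.mk' N')) (V.prod_closed _ _ hm hm')
  rwa [MonoidHom.ker_prod, QuotientGroup.ker_mk', QuotientGroup.ker_mk'] at this

lemma exists_coC_le {G : Type u} [Group G] {ι : Type*} [Finite ι] {K : Subgroup G}
    (hK : K ∈ V.coC G) (P : ι → Subgroup G → Prop)
    (hP : ∀ i N N', N' ≤ N → P i N → P i N')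
    (h : ∀ i, ∃ N ∈ V.coC G, P i N) :
    ∃ L ∈ V.coC G, L ≤ K ∧ ∀ i, P i L := by
  classical
  choose N hN hPN using h
  have key : ∀ s : Finset ι, ∃ L ∈ V.coC G, L ≤ K ∧ ∀ i ∈ s, L ≤ N i := by
    intro s
    induction s using Finset.induction_on with
    | empty => exact ⟨K, hK, le_rfl, by simp⟩
    | insert a s _ ih =>
      obtain ⟨L, hL, hLK, hs⟩ := ih
      refine ⟨L ⊓ N a, coC_inf hL (hN a), inf_le_left.trans hLK, ?_⟩
      intro i hi
      rcases Finset.mem_insert.1 hi with rfl | hi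
      · exact inf_le_right
      · exact inf_le_left.trans (hs i hi)
  have := Fintype.ofFinite ι
  obtain ⟨L, hL, hLK, hs⟩ := key Finset.univ
  exact ⟨L, hL, hLK, fun i => hP i _ _ (hs i (Finset.mem_univ i)) (hPN i)⟩

lemma mem_pi {ι : Type u} [Finite ι] {R : Type u} [Group R] (hR : V.mem R) :
    V.mem (ι → R) := by
  obtain ⟨L, ⟨hn, hm⟩, -, hL⟩ := exists_coC_le (V := V) (coC_ker (1 : (ι → R) →* R) hR)
    (fun (i : ι) N => N ≤ (Pi.evalMonoidHom (fun _ : ι => R) i).ker)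
    (fun i N N' h h' => h.trans h')
    (fun i => ⟨_, coC_ker (Pi.evalMonoidHom (fun _ : ι => R) i) hR, le_rfl⟩)
  refine mem_of_surj (MonoidHom.id (ι → R)) Function.surjective_id ⟨hn, hm⟩ ?_
  intro f hf
  ext i
  exact hL i hf

/-- open subgroups have the full induced topology -/
lemma exists_coC_of_open {G : Type u} [Group G] {H K : Subgroup G} (hK : K ∈ V.coC G)
    (hKH : K ≤ H) {N : Subgroup H} (hN : N ∈ V.coC H) :
    ∃ N' ∈ V.coC G, N' ≤ N.map H.subtype := by
  obtain ⟨hKn, hKm⟩ := hK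
  have hNn : N.Normal := hN.1
  have hfin : Finite (G ⧸ K) := V.finite _ hKm
  set D : Subgroup G := N.map H.subtype ⊓ K with hD
  -- conjugation homs
  let c : G → (K →* H) := fun g =>
    { toFun := fun k => ⟨g * k * g⁻¹, hKH (hKn.conj_mem _ k.2 g)⟩
      map_one' := by ext; simp
      map_mul' := by intro x y; ext; simp }
  have htop : (⊤ : Subgroup K) ∈ V.coC K :=
    coC_mono (coC_comap (Subgroup.inclusion hKH) hN) inferInstance le_top
  obtain ⟨L, hL, -, hLc⟩ := exists_coC_le (V := V) htop
    (fun (q : G ⧸ K) N' => N' ≤ N.comap (c q.out⁻¹))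
    (fun i N N' h h' => h.trans h')
    (fun q => ⟨_, coC_comap (c q.out⁻¹) hN, le_rfl⟩)
  have hle : L ≤ D.normalCore.subgroupOf K := by
    intro k hk
    rw [Subgroup.mem_subgroupOf]
    intro g
    refine ⟨?_, hKn.conj_mem _ k.2 g⟩
    have h1 := hLc ((g⁻¹ : G) : G ⧸ K) hk
    obtain ⟨t, ht⟩ := QuotientGroup.mk_out_eq_mul K g⁻¹
    rw [Subgroup.mem_comap] at h1
    refine ⟨⟨g * k * g⁻¹, hKH (hKn.conj_mem _ k.2 g)⟩, ?_, rfl⟩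
    have h2 := hNn.conj_mem _ h1 ⟨t, hKH t.2⟩
    rw [ht] at h2
    rw [SetLike.mem_coe]
    convert h2 using 1
    ext
    simp [c, mul_assoc]
  have hcore : D.normalCore.subgroupOf K ∈ V.coC K := coC_mono hL inferInstance hle
  refine ⟨D.normalCore, ⟨inferInstance, ?_⟩, (Subgroup.normalCore_le D).trans inf_le_left⟩
  have hnm : (K.map (QuotientGroup.mk' D.normalCore)).Normal :=
    hKn.map _ (QuotientGroup.mk'_surjective _)
  refine V.extension_closed _ (K.map (QuotientGroup.mk' D.normalCore)) ?_ ?_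
  · refine mem_of_surj ((QuotientGroup.mk' D.normalCore).subgroupMap K)
      ((QuotientGroup.mk' D.normalCore).subgroupMap_surjective K) hcore ?_
    intro k hk
    rw [MonoidHom.mem_ker]
    ext
    exact (QuotientGroup.eq_one_iff (k : G)).2 hk
  · refine mem_of_surj ((QuotientGroup.mk' (K.map (QuotientGroup.mk' D.normalCore))).comp
      (QuotientGroup.mk' D.normalCore))
      ((QuotientGroup.mk'_surjective _).comp (QuotientGroup.mk'_surjective _)) ⟨hKn, hKm⟩ ?_
    intro k hk
    rw [MonoidHom.mem_ker]
    exact (QuotientGroup.eq_one_iff _).2 ⟨k, hk, rfl⟩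

/-- for HCS groups, the `M`-classes are separable -/
lemma sep_class {B : Type u} [Group B] (hB : V.HCS B) {M : Subgroup B} (hM : M ∈ V.coC B)
    (g w : B) (hw : ∀ m ∈ M, m * g * m⁻¹ ≠ w) :
    ∃ L ∈ V.coC B, ∀ m ∈ M, (m * g * m⁻¹)⁻¹ * w ∉ L := by
  have hMn : M.Normal := hM.1
  set H : Subgroup B := M ⊔ Subgroup.zpowers g with hH
  have hMH : M ≤ H := le_sup_left
  have hgH : g ∈ H := (le_sup_right : _ ≤ H) (Subgroup.mem_zpowers g)
  by_cases hwH : w ∈ H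
  · have hcs := hB.2 H ⟨M, hM, hMH⟩ ⟨g, hgH⟩ ⟨w, hwH⟩ ?_
    · obtain ⟨N, hN, hsep⟩ := hcs
      obtain ⟨N', hN', hle⟩ := exists_coC_of_open hM hMH hN
      refine ⟨N', hN', ?_⟩
      intro m hm hmem
      obtain ⟨n, hn, hn'⟩ := hle hmem
      apply hsep
      refine ⟨⟨m, hMH hm⟩ * ⟨g, hgH⟩ * ⟨m, hMH hm⟩⁻¹, ?_, ?_⟩
      · exact isConj_iff.2 ⟨⟨m, hMH hm⟩, rfl⟩
      · rw [QuotientGroup.eq]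
        rw [SetLike.mem_coe] at hn
        convert hn using 1
        ext
        exact hn'.symm
    · intro hc
      obtain ⟨⟨h, hh⟩, hc⟩ := isConj_iff.1 hc
      have hc' : h * g * h⁻¹ = w := congrArg Subtype.val hc
      rw [hH, Subgroup.mem_sup_of_normal_left] at hh
      obtain ⟨m, hm, z, hz, rfl⟩ := hh
      obtain ⟨k, rfl⟩ := Subgroup.mem_zpowers_iff.1 hz
      apply hw m hm
      rw [← hc']
      group
  · refine ⟨M, hM, ?_⟩
    intro m hm hmem
    apply hwH
    have : m * g * m⁻¹ ∈ H := H.mul_mem (H.mul_mem (hMH hm) hgH) (H.inv_mem (hMH hm))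
    have h2 := H.mul_mem this (hMH hmem)
    rwa [mul_inv_cancel_left] at h2

lemma CC_of_HCS {B : Type u} [Group B] (hB : V.HCS B) {M : Subgroup B} (hM : M ∈ V.coC B)
    (g : B) : ∃ L ∈ V.coC B, L ≤ M ∧ ∀ x : B, (g * x)⁻¹ * (x * g) ∈ L →
      ∃ c, g * c = c * g ∧ c⁻¹ * x ∈ M := by
  have hMn : M.Normal := hM.1
  obtain ⟨_, hMm⟩ := id hM
  have hfin : Finite (B ⧸ M) := V.finite _ hMm
  obtain ⟨L, hL, hLM, h⟩ := exists_coC_le (V := V) hM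
    (fun (q : B ⧸ M) L => (∀ m ∈ M, m * g * m⁻¹ ≠ q.out⁻¹ * g * q.out) →
      ∀ m ∈ M, (m * g * m⁻¹)⁻¹ * (q.out⁻¹ * g * q.out) ∉ L)
    (fun q N N' hle hN hq m hm hmem => hN hq m hm (hle hmem))
    (fun q => by
      by_cases hq : ∀ m ∈ M, m * g * m⁻¹ ≠ q.out⁻¹ * g * q.out
      · obtain ⟨L, hL, h⟩ := sep_class hB hM g _ hq
        exact ⟨L, hL, fun _ => h⟩
      · exact ⟨M, hM, fun h => absurd h hq⟩)
  refine ⟨L, hL, hLM, ?_⟩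
  intro x hx
  have hLn : L.Normal := hL.1
  obtain ⟨t, ht⟩ := QuotientGroup.mk_out_eq_mul M x
  by_cases hq : ∀ m ∈ M, m * g * m⁻¹ ≠ (x : B ⧸ M).out⁻¹ * g * (x : B ⧸ M).out
  · exfalso
    refine h (x : B ⧸ M) hq (t : B)⁻¹ (M.inv_mem t.2) ?_
    rw [ht]
    have h1 : x⁻¹ * g⁻¹ * x * g ∈ L := by simpa [mul_assoc] using hx
    have h2 : g⁻¹ * (x⁻¹ * g * x) ∈ L := by
      have := L.inv_mem (hLn.conj_mem _ h1 1)
      simpa [mul_assoc] using this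
    have := hLn.conj_mem _ h2 (t : B)⁻¹
    convert this using 1
    group
  · push Not at hq
    obtain ⟨m, hm, he⟩ := hq
    rw [ht] at he
    refine ⟨x * t * m, ?_, ?_⟩
    · have : g * (x * t) = (x * t) * (m * g * m⁻¹) := by rw [he]; group
      calc g * (x * t * m) = g * (x * t) * m := by group
        _ = x * t * m * g := by rw [this]; group
    · have : (x * t * m)⁻¹ * x = (t * m)⁻¹ := by group
      rw [this]
      exact M.inv_mem (M.mul_mem t.2 hm)

lemma order_sep {B : Type u} [Group B]
    (hcyc : ∀ x : B, V.CSeparable ((Subgroup.zpowers x : Subgroup B) : Set B))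
    {M : Subgroup B} (hM : M ∈ V.coC B) (b : B) (d : ℕ) (hd : 0 < d) :
    ∃ L ∈ V.coC B, L ≤ M ∧ ∀ j : ℕ, b ^ j ∈ L → b ^ j ∈ Subgroup.zpowers (b ^ d) := by
  obtain ⟨L, hL, hLM, h⟩ := exists_coC_le (V := V) hM
    (fun (i : Fin d) L => b ^ (i : ℕ) ∉ Subgroup.zpowers (b ^ d) →
      ∀ z ∈ Subgroup.zpowers (b ^ d), z⁻¹ * b ^ (i : ℕ) ∉ L)
    (fun q N N' hle hN hq m hm hmem => hN hq m hm (hle hmem))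
    (fun i => by
      by_cases hi : b ^ (i : ℕ) ∈ Subgroup.zpowers (b ^ d)
      · exact ⟨M, hM, fun h => absurd hi h⟩
      · obtain ⟨N, hN, h⟩ := hcyc (b ^ d) _ hi
        refine ⟨N, hN, fun _ z hz hmem => h ⟨z, hz, ?_⟩⟩
        exact QuotientGroup.eq.2 hmem)
  refine ⟨L, hL, hLM, ?_⟩
  intro j hj
  have hjd : b ^ j = (b ^ d) ^ (j / d) * b ^ (j % d) := by
    rw [← pow_mul, ← pow_add, Nat.div_add_mod]
  have hz : (b ^ d) ^ (j / d) ∈ Subgroup.zpowers (b ^ d) := Subgroup.npow_mem_zpowers _ _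
  by_contra hcon
  refine h ⟨j % d, Nat.mod_lt _ hd⟩ ?_ _ (Subgroup.inv_mem _ hz) ?_
  · intro h'
    apply hcon
    rw [hjd]
    exact Subgroup.mul_mem _ hz h'
  · simp only [inv_inv]
    rwa [← hjd]

section Wreath
variable {A B R Q : Type u} [CommGroup A] [Group B] [CommGroup R] [Group Q]

open Classical in
/-- push-forward of the base group -/
noncomputable def push [Finite Q] (φ : A →* R) (ψ : B →* Q) :
    WreathBase A B →* WreathBase R Q where
  toFun f := ⟨fun q => ∏ᶠ y, if ψ y = q then φ ((f : B → A) y) else 1, Set.toFinite _⟩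
  map_one' := by
    ext q
    simp
  map_mul' f g := by
    ext q
    have h : ∀ f : WreathBase A B,
        (Function.mulSupport fun y => if ψ y = q then φ ((f : B → A) y) else 1).Finite := by
      intro f
      refine Set.Finite.subset f.2 ?_
      intro y hy hf
      apply hy
      simp [hf]
    change (∏ᶠ y, if ψ y = q then φ ((f : B → A) y * (g : B → A) y) else 1) =
      (∏ᶠ y, if ψ y = q then φ ((f : B → A) y) else 1) *
      (∏ᶠ y, if ψ y = q then φ ((g : B → A) y) else 1)
    rw [← finprod_mul_distrib (h f) (h g)]
    refine finprod_congr fun y => ?_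
    split_ifs <;> simp

open Classical in
lemma push_apply [Finite Q] (φ : A →* R) (ψ : B →* Q) (f : WreathBase A B) (q : Q) :
    (push φ ψ f : Q → R) q = ∏ᶠ y, if ψ y = q then φ ((f : B → A) y) else 1 := rfl

lemma wa_apply {A B : Type u} [Group A] [Group B] (c : B) (f : WreathBase A B) (x : B) :
    (wreathAction A B c f : B → A) x = (f : B → A) (c⁻¹ * x) := rfl

lemma push_equivariant [Finite Q] (φ : A →* R) (ψ : B →* Q) (c : B) (f : WreathBase A B) :
    push φ ψ (wreathAction A B c f) = wreathAction R Q (ψ c) (push φ ψ f) := by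
  classical
  ext q
  rw [wa_apply, push_apply, push_apply]
  rw [← finprod_comp_equiv (Equiv.mulLeft c)]
  refine finprod_congr fun y => ?_
  simp only [Equiv.coe_mulLeft, map_mul, wa_apply, inv_mul_cancel_left, eq_inv_mul_iff_mul_eq]

lemma push_surj [Finite Q] (φ : A →* R) (ψ : B →* Q) (hψ : Function.Surjective ψ)
    (g : WreathBase R Q) (hg : ∀ q, ∃ a, φ a = (g : Q → R) q) : ∃ f, push φ ψ f = g := by
  classical
  choose a ha using hg
  obtain ⟨s, hs⟩ := hψ.hasRightInverse
  refine ⟨⟨fun y => if s (ψ y) = y then a (ψ y) else 1, ?_⟩, ?_⟩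
  · refine (Set.finite_range s).subset ?_
    intro y hy
    by_contra hcon
    apply hy
    have : s (ψ y) ≠ y := fun h => hcon ⟨_, h⟩
    simp [this]
  · ext q
    rw [push_apply, finprod_eq_single _ (s q)]
    · simp [hs q, ha]
    · intro y hy
      split_ifs with h1
      · subst h1
        simp [Ne.symm hy]
      · rfl

/-- an invariant function is the product of translates of a function
supported on a transversal -/
lemma exists_trans [Finite Q] (β : Q) (g : WreathBase R Q)
    (hg : wreathAction R Q β g = g) : ∃ g1 : WreathBase R Q,
      (∀ q, (g1 : Q → R) q = (g : Q → R) q ∨ (g1 : Q → R) q = 1) ∧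
      g = ∏ i ∈ Finset.range (orderOf β), wreathAction R Q (β ^ i) g1 := by
  classical
  obtain ⟨T, hT, -⟩ := (Subgroup.zpowers β).exists_isComplement_right 1
  refine ⟨⟨fun q => if q ∈ T then (g : Q → R) q else 1, Set.toFinite _⟩, ?_, ?_⟩
  · intro q
    by_cases h : q ∈ T
    · left; simp [h]
    · right; simp [h]
  have hinv : ∀ (i : ℕ) q, (g : Q → R) ((β ^ i)⁻¹ * q) = (g : Q → R) q := by
    intro i
    induction i with
    | zero => simp
    | succ n ih =>
      intro q
      rw [pow_succ, mul_inv_rev, mul_assoc, ← wa_apply, hg, ih]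
  ext q
  rw [Subgroup.val_finsetProd, Finset.prod_apply]
  simp only [wa_apply, hinv]
  obtain ⟨⟨⟨z, hz⟩, ⟨t, ht⟩⟩, hzt, huniq⟩ :=
    Subgroup.isComplement_iff_existsUnique.1 hT q
  simp only at hzt
  obtain ⟨i, hi, hiz⟩ := (isOfFinOrder_of_finite β).mem_zpowers_iff_mem_range_orderOf.1 hz |> Finset.mem_image.1
  rw [Finset.prod_eq_single i]
  · have : (β ^ i)⁻¹ * q ∈ T := by rw [hiz, ← hzt, inv_mul_cancel_left]; exact ht
    simp [this]
  · intro j hj hji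
    have : (β ^ j)⁻¹ * q ∉ T := by
      intro hmem
      have h := huniq ⟨⟨β ^ j, Subgroup.npow_mem_zpowers _ _⟩, ⟨_, hmem⟩⟩ (by simp)
      have h2 : β ^ j = z := congrArg (fun p => ((p.1 : Subgroup.zpowers β) : Q)) h
      apply hji
      exact pow_injOn_Iio_orderOf (Finset.mem_range.1 hj) (Finset.mem_range.1 hi) (h2.trans hiz.symm)
    simp [this]
  · intro h; exact absurd hi h

open Classical in
/-- the delta function -/
noncomputable def delta (A B : Type u) [CommGroup A] [Group B] (y : B) : A →* WreathBase A B where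
  toFun a := ⟨Pi.mulSingle y a, (Set.finite_singleton y).subset Pi.mulSupport_mulSingle_subset⟩
  map_one' := by ext; simp
  map_mul' a b := by
    ext x
    simp [Pi.mulSingle_mul]

open Classical in
lemma delta_apply (y : B) (a : A) (x : B) :
    (delta A B y a : B → A) x = if x = y then a else 1 := by
  simp [delta, Pi.mulSingle_apply]

lemma wa_delta (c y : B) (a : A) : wreathAction A B c (delta A B y a) = delta A B (c * y) a := by
  classical
  ext x
  simp only [wa_apply, delta_apply, inv_mul_eq_iff_eq_mul]

lemma eq_prod_delta (f : WreathBase A B) :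
    f = ∏ y ∈ f.2.toFinset, delta A B y ((f : B → A) y) := by
  classical
  ext x
  rw [Subgroup.val_finsetProd, Finset.prod_apply]
  simp only [delta_apply]
  rw [Finset.prod_ite_eq]
  split_ifs with h
  · rfl
  · by_contra hx
    exact h (f.2.mem_toFinset.2 hx)

end Wreath

lemma mem_rwreath {R Q : Type u} [Group R] [Group Q] [Finite Q] (hR : V.mem R) (hQ : V.mem Q) :
    V.mem (RWreath R Q) := by
  have hbase : V.mem (WreathBase R Q) := V.subgroup_closed _ _ (mem_pi hR)
  refine V.extension_closed _ (SemidirectProduct.rightHom : RWreath R Q →* Q).ker ?_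
    (coC_ker (SemidirectProduct.rightHom : RWreath R Q →* Q) hQ).2
  rw [← SemidirectProduct.range_inl_eq_ker_rightHom]
  exact mem_of_surj (SemidirectProduct.inl : WreathBase R Q →* RWreath R Q).rangeRestrict
    (MonoidHom.rangeRestrict_surjective _) (coC_ker (MonoidHom.id _) hbase)
    (by intro x hx; rw [show x = 1 from hx]; exact Subgroup.one_mem _)

lemma prod_periodic {R : Type*} [CommGroup R] (h : ℕ → R) (m : ℕ) (hp : ∀ i, h (i + m) = h i)
    (k : ℕ) : ∏ i ∈ Finset.range (m * k), h i = (∏ i ∈ Finset.range m, h i) ^ k := by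
  have hp' : ∀ k i, h (m * k + i) = h i := by
    intro k
    induction k with
    | zero => simp
    | succ n ih =>
      intro i
      rw [← ih i, ← hp (m * n + i)]
      congr 1
      ring
  induction k with
  | zero => simp
  | succ n ih =>
    rw [Nat.mul_succ, Finset.prod_range_add, ih, pow_succ]
    simp only [hp']

section Main
variable {A B : Type u} [CommGroup A] [Group B]

/-- trace of `K` on the base -/
abbrev KF (K : Subgroup (RWreath A B)) : Subgroup (WreathBase A B) :=
  K.comap (SemidirectProduct.inl : WreathBase A B →* RWreath A B)

lemma mk_wa (K : Subgroup (RWreath A B)) [hK : K.Normal] (m : B)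
    (hm : (SemidirectProduct.inr m : RWreath A B) ∈ K) (f : WreathBase A B) :
    (QuotientGroup.mk (wreathAction A B m f) : WreathBase A B ⧸ KF K) = QuotientGroup.mk f := by
  rw [eq_comm, QuotientGroup.eq, Subgroup.mem_comap, map_mul, SemidirectProduct.inl_aut, map_inv]
  have h1 := hK.conj_mem _ hm (SemidirectProduct.inl f : RWreath A B)⁻¹
  have h2 := K.mul_mem h1 (K.inv_mem hm)
  rw [← map_inv] at h2
  convert h2 using 1
  simp [mul_assoc]

lemma wa_KF (K : Subgroup (RWreath A B)) [hK : K.Normal] (c : B) :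
    KF K ≤ (KF K).comap (wreathAction A B c).toMonoidHom := by
  intro f hf
  change (SemidirectProduct.inl (wreathAction A B c f) : RWreath A B) ∈ K
  rw [SemidirectProduct.inl_aut]
  have := hK.conj_mem _ hf (SemidirectProduct.inr c : RWreath A B)
  rwa [← map_inv] at this

/-- coefficient map -/
noncomputable abbrev phi (K : Subgroup (RWreath A B)) [K.Normal] :
    A →* WreathBase A B ⧸ KF K :=
  (QuotientGroup.mk' (KF K)).comp (delta A B 1)

lemma push_ker (K : Subgroup (RWreath A B)) [hK : K.Normal] {Q : Type u} [Group Q] [Finite Q]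
    (ψ : B →* Q) (hψ : Function.Surjective ψ)
    (hker : ∀ m, ψ m = 1 → (SemidirectProduct.inr m : RWreath A B) ∈ K)
    (f : WreathBase A B) (hf : push (phi K) ψ f = 1) : f ∈ KF K := by
  classical
  have := Fintype.ofFinite Q
  obtain ⟨s, hs⟩ := hψ.hasRightInverse
  let α : Q → (WreathBase A B ⧸ KF K →* WreathBase A B ⧸ KF K) := fun q =>
    QuotientGroup.map _ _ (wreathAction A B (s q)).toMonoidHom (wa_KF K (s q))
  have hα : ∀ y a, (QuotientGroup.mk' (KF K)) (delta A B y a) = α (ψ y) (phi K a) := by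
    intro y a
    have h1 : α (ψ y) (phi K a) =
      QuotientGroup.mk' (KF K) (wreathAction A B (s (ψ y)) (delta A B 1 a)) := rfl
    rw [h1, wa_delta, mul_one]
    have h2 : delta A B (s (ψ y)) a = wreathAction A B (s (ψ y) * y⁻¹) (delta A B y a) := by
      rw [wa_delta, inv_mul_cancel_right]
    rw [h2]
    exact (mk_wa K _ (hker _ (by simp [hs (ψ y)])) _).symm
  rw [← QuotientGroup.eq_one_iff, ← QuotientGroup.mk'_apply]
  conv_lhs => rw [eq_prod_delta f]
  rw [map_prod]
  simp only [hα]
  rw [← Finset.prod_fiberwise f.2.toFinset ψ]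
  refine Finset.prod_eq_one fun q _ => ?_
  have hq : (push (phi K) ψ f : Q → WreathBase A B ⧸ KF K) q = 1 := by rw [hf]; rfl
  rw [push_apply, finprod_eq_prod_of_mulSupport_subset (s := f.2.toFinset)] at hq
  · rw [← Finset.prod_filter] at hq
    calc _ = ∏ y ∈ f.2.toFinset with ψ y = q, α q (phi K ((f : B → A) y)) := by
          refine Finset.prod_congr rfl fun y hy => ?_
          rw [(Finset.mem_filter.1 hy).2]
      _ = 1 := by rw [← map_prod, hq, map_one]
  · intro y hy
    refine Finset.mem_coe.2 (f.2.mem_toFinset.2 ?_)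
    intro h
    apply hy
    simp only
    rw [h]
    simp

theorem main (hB : V.HCS B)
    (hcyc : ∀ x : B, V.CSeparable ((Subgroup.zpowers x : Subgroup B) : Set B))
    (b : B) :
    V.SatisfiesCCAt (SemidirectProduct.inr b : RWreath A B) := by
  classical
  intro K hK
  have hKn : K.Normal := hK.1
  have hM : K.comap (SemidirectProduct.inr : B →* RWreath A B) ∈ V.coC B := coC_comap _ hK
  set M := K.comap (SemidirectProduct.inr : B →* RWreath A B) with hMdef
  have hMn : M.Normal := hM.1
  have hMfin : Finite (B ⧸ M) := V.finite _ hM.2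
  have hR : V.mem (WreathBase A B ⧸ KF K) := (coC_comap _ hK).2
  have hRfin : Finite (WreathBase A B ⧸ KF K) := V.finite _ hR
  set n := Nat.card (WreathBase A B ⧸ KF K) with hn
  have hnpos : 0 < n := Nat.card_pos
  set m := orderOf (b : B ⧸ M) with hm
  have hmpos : 0 < m := orderOf_pos _
  have hbm : b ^ m ∈ M := by
    rw [← QuotientGroup.eq_one_iff, QuotientGroup.mk_pow]
    exact pow_orderOf_eq_one _
  set d := if IsOfFinOrder b then orderOf b else m * n with hd
  have hdpos : 0 < d := by
    rw [hd]
    split_ifs with h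
    · exact h.orderOf_pos
    · positivity
  obtain ⟨L1, hL1, hL1M, hord⟩ := order_sep hcyc hM b d hdpos
  obtain ⟨L2, hL2, hL2M, hcc⟩ := CC_of_HCS hB hM b
  have hM1 := coC_inf hL1 hL2
  set M1 := L1 ⊓ L2 with hM1def
  have hM1n : M1.Normal := hM1.1
  have hM1m : V.mem (B ⧸ M1) := hM1.2
  have hM1fin : Finite (B ⧸ M1) := V.finite _ hM1m
  set ψ := QuotientGroup.mk' M1 with hψ
  have hψs : Function.Surjective ψ := QuotientGroup.mk'_surjective M1
  have hker1 : ∀ x, ψ x = 1 → x ∈ M1 := fun x hx => (QuotientGroup.eq_one_iff x).1 hx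
  have hker : ∀ x, ψ x = 1 → (SemidirectProduct.inr x : RWreath A B) ∈ K :=
    fun x hx => hL1M (hker1 x hx).1
  let Φ : RWreath A B →* RWreath (WreathBase A B ⧸ KF K) (B ⧸ M1) :=
    SemidirectProduct.map (push (phi K) ψ) ψ (fun c => by
      ext1 f
      exact push_equivariant (phi K) ψ c f)
  have hsplit : ∀ x : RWreath A B,
      x = SemidirectProduct.inl x.left * SemidirectProduct.inr x.right :=
    fun x => (SemidirectProduct.inl_left_mul_inr_right x).symm
  refine ⟨Φ.ker, coC_ker Φ (mem_rwreath hR hM1m), ?_, inferInstance, ?_⟩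
  · intro x hx
    rw [hsplit x]
    have hl : push (phi K) ψ x.left = 1 := congrArg SemidirectProduct.left hx
    have hr : ψ x.right = 1 := congrArg SemidirectProduct.right hx
    exact K.mul_mem (push_ker K ψ hψs hker _ hl) (hker _ hr)
  · intro xq hxq
    obtain ⟨x, rfl⟩ := QuotientGroup.mk_surjective xq
    refine ⟨x, ?_, rfl⟩
    have hcom : Φ (SemidirectProduct.inr b * x) = Φ (x * SemidirectProduct.inr b) := by
      have h1 := Subgroup.mem_centralizer_iff.1 hxq _ rfl
      rw [← QuotientGroup.mk_mul, ← QuotientGroup.mk_mul, QuotientGroup.eq, MonoidHom.mem_ker,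
        map_mul, map_inv, inv_mul_eq_one] at h1
      exact h1
    have hleft : wreathAction _ _ (ψ b) (push (phi K) ψ x.left) = push (phi K) ψ x.left := by
      have h1 := congrArg SemidirectProduct.left hcom
      simpa [Φ, push_equivariant] using h1
    have hright : (b * x.right)⁻¹ * (x.right * b) ∈ M1 := by
      have h1 := congrArg SemidirectProduct.right hcom
      apply hker1
      rw [map_mul, map_inv, inv_mul_eq_one]
      simpa [Φ] using h1
    obtain ⟨c, hc, hcx⟩ := hcc _ hright.2
    -- base part
    obtain ⟨g1, hg1, hg⟩ := exists_trans (ψ b) (push (phi K) ψ x.left) hleft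
    obtain ⟨f1, hf1⟩ := push_surj (phi K) ψ hψs g1 (by
      intro q
      rcases hg1 q with h | h
      · rw [h, push_apply]
        refine finprod_induction (fun r => ∃ a, phi K a = r) ⟨1, map_one _⟩ ?_ ?_
        · rintro _ _ ⟨a, rfl⟩ ⟨a', rfl⟩
          exact ⟨a * a', map_mul _ _ _⟩
        · intro y
          split_ifs
          · exact ⟨_, rfl⟩
          · exact ⟨1, map_one _⟩
      · exact ⟨1, by rw [h, map_one]⟩)
    set o := orderOf (ψ b) with ho
    set f2 := ∏ i ∈ Finset.range o, wreathAction A B (b ^ i) f1 with hf2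
    have hpush : push (phi K) ψ f2 = push (phi K) ψ x.left := by
      rw [hg, hf2, map_prod]
      refine Finset.prod_congr rfl fun i _ => ?_
      rw [push_equivariant, map_pow, hf1]
    have hf2K : f2⁻¹ * x.left ∈ KF K := by
      apply push_ker K ψ hψs hker
      rw [map_mul, map_inv, hpush, inv_mul_cancel]
    have hbo : b ^ o ∈ L1 := by
      have h1 : ψ (b ^ o) = 1 := by rw [map_pow]; exact pow_orderOf_eq_one _
      exact (hker1 _ h1).1
    have hz := hord o hbo
    have hf0 : ∃ f0, wreathAction A B b f0 = f0 ∧ f0⁻¹ * x.left ∈ KF K := by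
      by_cases hfo : IsOfFinOrder b
      · refine ⟨f2, ?_, hf2K⟩
        have hd' : d = orderOf b := by rw [hd, if_pos hfo]
        rw [hd', pow_orderOf_eq_one, Subgroup.zpowers_one_eq_bot, Subgroup.mem_bot] at hz
        rw [hf2, map_prod]
        have e : ∀ i, wreathAction A B b (wreathAction A B (b ^ i) f1) =
            wreathAction A B (b ^ (i + 1)) f1 := by
          intro i
          rw [pow_succ', map_mul]
          rfl
        simp only [e]
        have h1 := Finset.prod_range_succ (fun i => wreathAction A B (b ^ i) f1) o
        rw [Finset.prod_range_succ', hz, pow_zero] at h1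
        exact mul_right_cancel h1
      · refine ⟨1, map_one _, ?_⟩
        have hd' : d = m * n := by rw [hd, if_neg hfo]
        obtain ⟨k, hk⟩ := Subgroup.mem_zpowers_iff.1 hz
        have hinj : Function.Injective fun z : ℤ => b ^ z :=
          injective_zpow_iff_not_isOfFinOrder.2 hfo
        have hk' : (d : ℤ) * k = o := by
          apply hinj
          simp only [zpow_mul, zpow_natCast]
          exact hk
        have hdvd : d ∣ o := Int.natCast_dvd_natCast.1 ⟨k, hk'.symm⟩
        obtain ⟨l, hl⟩ := hdvd
        have hf2' : f2 ∈ KF K := by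
          rw [← QuotientGroup.eq_one_iff, ← QuotientGroup.mk'_apply, hf2, map_prod, hl, hd',
            mul_assoc, prod_periodic, pow_mul, hn, pow_card_eq_one', one_pow]
          intro i
          rw [add_comm, pow_add, map_mul]
          exact mk_wa K _ hbm _
        have := (KF K).mul_mem hf2' hf2K
        rw [mul_inv_cancel_left] at this
        simpa using this
    obtain ⟨f0, hf0b, hf0K⟩ := hf0
    refine ⟨SemidirectProduct.inl f0 * SemidirectProduct.inr c, ?_,
      (SemidirectProduct.inr c)⁻¹ * SemidirectProduct.inl (f0⁻¹ * x.left) *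
        SemidirectProduct.inr c * SemidirectProduct.inr (c⁻¹ * x.right), ?_, ?_⟩
    · refine Subgroup.mem_centralizer_iff.2 ?_
      rintro _ rfl
      have h1 : (SemidirectProduct.inr b * SemidirectProduct.inl f0 : RWreath A B) =
          SemidirectProduct.inl f0 * SemidirectProduct.inr b := by
        have := SemidirectProduct.inl_aut (φ := wreathAction A B) b f0
        rw [hf0b] at this
        conv_rhs => rw [this]
        simp [mul_assoc]
      rw [← mul_assoc, h1, mul_assoc, mul_assoc, ← map_mul, ← map_mul, hc]
    · refine K.mul_mem ?_ hcx
      have := hKn.conj_mem _ hf0K (SemidirectProduct.inr c : RWreath A B)⁻¹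
      rwa [inv_inv] at this
    · conv_rhs => rw [hsplit x]
      simp only [map_mul, map_inv]
      group

end Main
end AECC

/-- If `A` is abelian and residually-`𝒞`, and `B` is infinite `𝒞`-HCS
with all cyclic subgroups `𝒞`-separable, then every `b ∈ B` satisfies the
`𝒞`-centralizer condition in `A ≀ B`. -/
theorem acting_elements_CC (V : ECPseudoVariety.{u}) (A B : Type u) [Group A] [Group B]
    (habA : ∀ x y : A, x * y = y * x) (hresA : V.Residually A)
    [Infinite B] (hB : V.HCS B)
    (hcyc : ∀ x : B, V.CSeparable ((Subgroup.zpowers x : Subgroup B) : Set B))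
    (b : B) :
    V.SatisfiesCCAt (SemidirectProduct.inr b : RWreath A B) := by
  letI : CommGroup A := { (inferInstance : Group A) with mul_comm := habA }
  exact AECC.main (A := A) hB hcyc b
end

section
/- Let 𝒞 be an extension-closed pseudo-variety of finite groups, and let A and B be groups such that A is abelian and residually-𝒞 and B is an infinite 𝒞-hereditarily conjugacy separable group each of whose cyclic subgroups is 𝒞-separable in B. Then every element f of the base group ⨁_{x∈B} A satisfies the 𝒞-centralizer condition in G = A ≀ B. -/
open Pointwise

universe u

namespace ECPseudoVariety

lemma aux_ker (V : ECPseudoVariety.{u}) {G H : Type u} [Group G] [Group H] (φ : G →* H)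
    (h : V.mem H) : φ.ker ∈ V.coC G :=
  ⟨inferInstance, V.iso_closed _ _ (QuotientGroup.quotientKerEquivRange φ).symm
    (V.subgroup_closed H φ.range h)⟩

lemma aux_comap (V : ECPseudoVariety.{u}) {G H : Type u} [Group G] [Group H] (φ : G →* H)
    {K : Subgroup H} (h : K ∈ V.coC H) : K.comap φ ∈ V.coC G := by
  obtain ⟨hN, hm⟩ := h
  have := V.aux_ker ((QuotientGroup.mk' K).comp φ) hm
  rwa [← MonoidHom.comap_ker, QuotientGroup.ker_mk'] at this

lemma aux_inf (V : ECPseudoVariety.{u}) {G : Type u} [Group G] 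
    {K L : Subgroup G} (h : K ∈ V.coC G) (h' : L ∈ V.coC G) : K ⊓ L ∈ V.coC G := by
  obtain ⟨hN, hm⟩ := h
  obtain ⟨hN', hm'⟩ := h'
  have := V.aux_ker ((QuotientGroup.mk' K).prod (QuotientGroup.mk' L)) (V.prod_closed _ _ hm hm')
  rwa [MonoidHom.ker_prod, QuotientGroup.ker_mk', QuotientGroup.ker_mk'] at this

lemma aux_triv (V : ECPseudoVariety.{u}) {H : Type u} [Group H] (h : V.mem H)
    (G : Type u) [Group G] [Unique G] : V.mem G :=
  V.iso_closed (⊥ : Subgroup H) G (MulEquiv.ofUnique) (V.subgroup_closed H ⊥ h)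

lemma aux_pi (V : ECPseudoVariety.{u}) {H : Type u} [Group H] (h : V.mem H)
    (ι : Type u) [Finite ι] : V.mem (ι → H) := by
  induction ι using Finite.induction_empty_option with
  | of_equiv e ih => 
    exact V.iso_closed _ _ (MulEquiv.arrowCongr e (MulEquiv.refl H)) ih
  | h_empty => exact V.aux_triv h _
  | h_option ih =>
    rename_i α _
    refine V.iso_closed ((α → H) × H) (Option α → H) ?_ (V.prod_closed _ _ ih h)
    exact 
      { toFun := fun p o => o.elim p.2 p.1
        invFun := fun q => (fun a => q (some a), q none)
        left_inv := fun p => rfl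
        right_inv := fun q => by funext o; cases o <;> rfl
        map_mul' := fun p q => by funext o; cases o <;> rfl }

lemma aux_top (V : ECPseudoVariety.{u}) {H : Type u} [Group H] (h : V.mem H)
    (G : Type u) [Group G] : (⊤ : Subgroup G) ∈ V.coC G := by
  have := V.aux_ker (1 : G →* (PUnit : Type u)) (V.aux_triv h _)
  rwa [MonoidHom.ker_one] at this

lemma aux_inj (V : ECPseudoVariety.{u}) {H : Type u} [Group H] (h : V.mem H)
    {G : Type u} [Group G] (hG : V.Residually G) (T : Set G) (hT : T.Finite) :
    ∃ N ∈ V.coC G, ∀ x ∈ T, ∀ y ∈ T, x⁻¹ * y ∈ N → x = y := by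
  have key : ∀ U : Set G, U.Finite → ∃ N ∈ V.coC G, ∀ x ∈ U, x ∈ N → x = 1 := by
    intro U hU
    induction U, hU using Set.Finite.induction_on with
    | empty => exact ⟨⊤, V.aux_top h G, by simp⟩
    | @insert a s _ _ ih =>
      obtain ⟨N, hN, hN'⟩ := ih
      by_cases ha : a = 1
      · refine ⟨N, hN, ?_⟩
        rintro x (rfl | hx) hxN
        · exact ha
        · exact hN' x hx hxN
      · obtain ⟨M, hM, haM⟩ := hG a ha
        refine ⟨N ⊓ M, V.aux_inf hN hM, ?_⟩
        rintro x (rfl | hx) hxN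
        · exact absurd hxN.2 haM
        · exact hN' x hx hxN.1
  obtain ⟨N, hN, hN'⟩ := key (Set.image2 (fun x y => x⁻¹ * y) T T) (hT.image2 _ hT)
  refine ⟨N, hN, fun x hx y hy hxy => ?_⟩
  exact inv_mul_eq_one.mp (hN' _ ⟨x, hx, y, hy, rfl⟩ hxy)

lemma aux_wreath (V : ECPseudoVariety.{u}) {A B : Type u} [Group A] [Group B] (hA : V.mem A)
    (hB : V.mem B) : V.mem (RWreath A B) := by
  haveI := V.finite B hB
  have h1 : V.mem (WreathBase A B) := V.subgroup_closed _ _ (V.aux_pi hA B)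
  have h2 : V.mem (SemidirectProduct.rightHom : RWreath A B →* B).ker := by
    rw [← SemidirectProduct.range_inl_eq_ker_rightHom]
    exact V.iso_closed _ _ (MonoidHom.ofInjective SemidirectProduct.inl_injective) h1
  refine V.extension_closed _ (SemidirectProduct.rightHom : RWreath A B →* B).ker h2 ?_
  exact (V.aux_ker (SemidirectProduct.rightHom : RWreath A B →* B) hB).2

end ECPseudoVariety

section push
variable {A B A' B' : Type u} [CommGroup A] [Group B] [CommGroup A'] [Group B'] [Finite B']

lemma aux_supp (α : A →* A') (β : B →* B') (f : WreathBase A B) (q : B') :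
    ({x | β x = q} ∩ Function.mulSupport (fun x => α ((f : B → A) x))).Finite := by
  refine Set.Finite.subset f.2 ?_
  rintro x ⟨-, hx⟩ h
  apply hx
  show α ((f : B → A) x) = 1
  rw [h, map_one]

noncomputable def auxPush (α : A →* A') (β : B →* B') : WreathBase A B →* WreathBase A' B' where
  toFun f := ⟨fun q => ∏ᶠ x ∈ {x | β x = q}, α ((f : B → A) x), Set.toFinite _⟩
  map_one' := by
    apply Subtype.ext
    funext q
    simp
  map_mul' f g := by
    apply Subtype.ext
    funext q
    show _ = (∏ᶠ x ∈ {x | β x = q}, α ((f : B → A) x)) * (∏ᶠ x ∈ {x | β x = q}, α ((g : B → A) x))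
    rw [← finprod_mem_mul_distrib' (aux_supp α β f q) (aux_supp α β g q)]
    simp

lemma auxPush_shift (α : A →* A') (β : B →* B') (c : B) (f : WreathBase A B) :
    auxPush α β (wreathAction A B c f) = wreathAction A' B' (β c) (auxPush α β f) := by
  apply Subtype.ext
  funext q
  show ∏ᶠ x ∈ {x | β x = q}, α ((f : B → A) (c⁻¹ * x)) =
    ∏ᶠ x ∈ {x | β x = (β c)⁻¹ * q}, α ((f : B → A) x)
  refine finprod_mem_eq_of_bijOn (fun x => c⁻¹ * x) ⟨?_, ?_, ?_⟩ (fun x _ => rfl)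
  · intro x hx
    simp only [Set.mem_setOf_eq] at hx ⊢
    simp [hx]
  · exact (mul_right_injective c⁻¹).injOn
  · intro y hy
    simp only [Set.mem_setOf_eq] at hy
    exact ⟨c * y, by simp [hy], by simp⟩

noncomputable def auxHom (α : A →* A') (β : B →* B') : RWreath A B →* RWreath A' B' :=
  SemidirectProduct.map (auxPush α β) β (fun c => by
    ext1 f
    exact auxPush_shift α β c f)

lemma auxPush_apply (α : A →* A') (β : B →* B') (f : WreathBase A B)
    (hβ : ∀ s ∈ Function.mulSupport (f : B → A), ∀ t ∈ Function.mulSupport (f : B → A),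
      β s = β t → s = t) (t : B) (ht : t ∈ Function.mulSupport (f : B → A)) :
    (auxPush α β f : B' → A') (β t) = α ((f : B → A) t) := by
  show ∏ᶠ x ∈ {x | β x = β t}, α ((f : B → A) x) = _
  rw [← finprod_mem_singleton (f := fun x => α ((f : B → A) x)) (a := t)]
  refine finprod_mem_inter_mulSupport_eq' _ _ _ ?_
  intro x hx
  have hx' : x ∈ Function.mulSupport (f : B → A) := by
    intro h
    apply hx
    show α ((f : B → A) x) = 1
    rw [h, map_one]
  constructor
  · intro h
    exact hβ _ hx' _ ht h
  · rintro rfl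
    rfl

lemma auxPush_ne (α : A →* A') (β : B →* B') (f : WreathBase A B) (q : B')
    (h : (auxPush α β f : B' → A') q ≠ 1) :
    ∃ t ∈ Function.mulSupport (f : B → A), β t = q := by
  obtain ⟨x, hx, hx'⟩ := exists_ne_one_of_finprod_mem_ne_one h
  refine ⟨x, fun h => hx' ?_, hx⟩
  rw [h, map_one]

/-- stabilizer lifting -/
lemma auxPush_stab (α : A →* A') (β : B →* B') (f : WreathBase A B) (hf : f ≠ 1)
    (hα : ∀ x ∈ insert 1 (Set.range (f : B → A)), ∀ y ∈ insert 1 (Set.range (f : B → A)),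
      α x = α y → x = y)
    (hβ : ∀ x ∈ Set.image2 (fun t s : B => t * s⁻¹) (Function.mulSupport (f : B → A))
        (Function.mulSupport (f : B → A)),
      ∀ y ∈ Set.image2 (fun t s : B => t * s⁻¹) (Function.mulSupport (f : B → A))
        (Function.mulSupport (f : B → A)), β x = β y → x = y)
    (c : B) (hc : wreathAction A' B' (β c) (auxPush α β f) = auxPush α β f) :
    ∃ c' : B, β c' = β c ∧ wreathAction A B c' f = f := by
  have hβ' : ∀ s ∈ Function.mulSupport (f : B → A), ∀ t ∈ Function.mulSupport (f : B → A),
      β s = β t → s = t := by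
    intro s hs t ht h
    have := hβ (s * t⁻¹) ⟨s, hs, t, ht, rfl⟩ (t * t⁻¹) ⟨t, ht, t, ht, rfl⟩ (by simp [h])
    exact mul_right_cancel this
  have hσ : ∀ s ∈ Function.mulSupport (f : B → A), ∃ t ∈ Function.mulSupport (f : B → A),
      β t = β c * β s ∧ (f : B → A) t = (f : B → A) s := by
    intro s hs
    have h1 : (auxPush α β f : B' → A') (β c * β s) = α ((f : B → A) s) := by
      rw [← auxPush_apply α β f hβ' s hs]
      conv_lhs => rw [← hc]
      show (auxPush α β f : B' → A') ((β c)⁻¹ * (β c * β s)) = _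
      rw [inv_mul_cancel_left]
    have h2 : α ((f : B → A) s) ≠ 1 := by
      intro h
      exact hs (hα _ (Or.inr ⟨s, rfl⟩) 1 (Or.inl rfl) (by rw [h, map_one]))
    obtain ⟨t, ht, ht'⟩ := auxPush_ne α β f _ (h1 ▸ h2)
    refine ⟨t, ht, ht', ?_⟩
    apply hα _ (Or.inr ⟨t, rfl⟩) _ (Or.inr ⟨s, rfl⟩)
    rw [← h1, ← ht', auxPush_apply α β f hβ' t ht]
  have hne : ∃ s, s ∈ Function.mulSupport (f : B → A) := by
    by_contra hcon
    push Not at hcon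
    apply hf
    apply Subtype.ext
    funext x
    simpa using hcon x
  obtain ⟨s₀, hs₀⟩ := hne
  obtain ⟨t₀, ht₀, hb₀, -⟩ := hσ s₀ hs₀
  have hc'S : ∀ s ∈ Function.mulSupport (f : B → A),
      (f : B → A) (t₀ * s₀⁻¹ * s) = (f : B → A) s := by
    intro s hs
    obtain ⟨t, ht, hb, hfe⟩ := hσ s hs
    have : t * s⁻¹ = t₀ * s₀⁻¹ := hβ _ ⟨t, ht, s, hs, rfl⟩ _ ⟨t₀, ht₀, s₀, hs₀, rfl⟩
      (by simp [hb, hb₀])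
    rw [← this, inv_mul_cancel_right, hfe]
  refine ⟨t₀ * s₀⁻¹, by simp [hb₀], ?_⟩
  set c' := t₀ * s₀⁻¹ with hc'
  have hmaps : Set.MapsTo (fun x => c' * x) (Function.mulSupport (f : B → A))
      (Function.mulSupport (f : B → A)) := by
    intro s hs
    show (f : B → A) (c' * s) ≠ 1
    rw [hc'S s hs]; exact hs
  have hsurj : Set.SurjOn (fun x => c' * x) (Function.mulSupport (f : B → A))
      (Function.mulSupport (f : B → A)) :=
    (Set.Finite.injOn_iff_bijOn_of_mapsTo f.2 hmaps).mp
      ((mul_right_injective c').injOn) |>.surjOn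
  apply Subtype.ext
  funext x
  show (f : B → A) (c'⁻¹ * x) = (f : B → A) x
  by_cases hx : x ∈ Function.mulSupport (f : B → A)
  · obtain ⟨s, hs, rfl⟩ := hsurj hx
    simp only [inv_mul_cancel_left]
    exact (hc'S s hs).symm
  · have h1 : c'⁻¹ * x ∉ Function.mulSupport (f : B → A) := by
      intro h
      apply hx
      have := hmaps h
      simpa using this
    rw [Function.notMem_mulSupport.mp hx, Function.notMem_mulSupport.mp h1]

end push

theorem aux_main (V : ECPseudoVariety.{u}) (A B : Type u) [CommGroup A] [Group B]
    (hresA : V.Residually A)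
    (hcyc : ∀ x : B, V.CSeparable ((Subgroup.zpowers x : Subgroup B) : Set B))
    (f : WreathBase A B) :
    V.SatisfiesCCAt (SemidirectProduct.inl f : RWreath A B) := by
  intro K hK
  obtain ⟨hKn, hKm⟩ := id hK
  by_cases hf : f = 1
  · subst hf
    refine ⟨K, hK, le_rfl, hKn, ?_⟩
    intro x _
    obtain ⟨g, rfl⟩ := QuotientGroup.mk_surjective x
    refine ⟨g, ⟨g, ?_, 1, K.one_mem, mul_one g⟩, rfl⟩
    simp [Subgroup.mem_centralizer_iff]
  have hresB : V.Residually B := by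
    intro g hg
    obtain ⟨N, hN, h⟩ := hcyc 1 g (by simpa using hg)
    refine ⟨N, hN, fun hgN => h ⟨1, by simp, ?_⟩⟩
    rw [QuotientGroup.eq]
    simpa using hgN
  have hS := f.2
  have hR : (insert 1 (Set.range (f : B → A))).Finite := by
    refine Set.Finite.subset ((hS.image (f : B → A)).insert 1) ?_
    rintro x (rfl | ⟨y, rfl⟩)
    · exact Or.inl rfl
    · by_cases h : (f : B → A) y = 1
      · exact Or.inl h
      · exact Or.inr ⟨y, h, rfl⟩
  obtain ⟨NA, hNA, hNA'⟩ := V.aux_inj hKm hresA _ hR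
  obtain ⟨N1, hN1, hN1'⟩ := V.aux_inj hKm hresB _ (hS.image2 (fun t s : B => t * s⁻¹) hS)
  have hNB : N1 ⊓ K.comap SemidirectProduct.inr ∈ V.coC B := V.aux_inf hN1 (V.aux_comap _ hK)
  set NB := N1 ⊓ K.comap SemidirectProduct.inr with hNBdef
  obtain ⟨nA, mA⟩ := hNA
  obtain ⟨nB, mB⟩ := hNB
  haveI := V.finite _ mB
  let φ : RWreath A B →* RWreath (A ⧸ NA) (B ⧸ NB) :=
    auxHom (QuotientGroup.mk' NA) (QuotientGroup.mk' NB)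
  have hφ : φ.ker ∈ V.coC (RWreath A B) := V.aux_ker φ (V.aux_wreath mA mB)
  have hL := V.aux_inf hφ hK
  refine ⟨φ.ker ⊓ K, hL, inf_le_right, hL.1, ?_⟩
  intro x hx
  obtain ⟨g, rfl⟩ := QuotientGroup.mk_surjective x
  have hcomm : φ (SemidirectProduct.inl f) * φ g = φ g * φ (SemidirectProduct.inl f) := by
    have h1 := Subgroup.mem_centralizer_iff.mp hx _ rfl
    rw [← QuotientGroup.mk_mul, ← QuotientGroup.mk_mul, QuotientGroup.eq] at h1
    have h2 : φ _ = 1 := h1.1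
    rw [map_mul, map_inv, inv_mul_eq_one, map_mul, map_mul] at h2
    exact h2
  have hl := congrArg SemidirectProduct.left hcomm
  have hc : wreathAction (A ⧸ NA) (B ⧸ NB) (QuotientGroup.mk' NB g.right)
      (auxPush (QuotientGroup.mk' NA) (QuotientGroup.mk' NB) f) =
      auxPush (QuotientGroup.mk' NA) (QuotientGroup.mk' NB) f := by
    simp only [φ, auxHom, SemidirectProduct.mul_left, SemidirectProduct.map_left,
      SemidirectProduct.map_right, SemidirectProduct.left_inl, SemidirectProduct.right_inl,
      map_one, MulAut.one_apply] at hl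
    have hcm : ∀ a b : WreathBase (A ⧸ NA) (B ⧸ NB), a * b = b * a := fun a b =>
      Subtype.ext (mul_comm (a : (B ⧸ NB) → (A ⧸ NA)) b)
    rw [hcm] at hl
    exact (mul_left_cancel hl).symm
  obtain ⟨c', hc', hst⟩ := auxPush_stab (QuotientGroup.mk' NA) (QuotientGroup.mk' NB) f hf
    (fun x hx y hy h => hNA' x hx y hy (QuotientGroup.eq.mp h))
    (fun x hx y hy h => hN1' x hx y hy (QuotientGroup.eq.mp h).1) g.right hc
  have hn : c'⁻¹ * g.right ∈ NB := QuotientGroup.eq.mp hc'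
  refine ⟨g, ⟨SemidirectProduct.inl g.left * SemidirectProduct.inr c', ?_,
    SemidirectProduct.inr (c'⁻¹ * g.right), hn.2, ?_⟩, rfl⟩
  · rw [SetLike.mem_coe, Subgroup.mem_centralizer_iff]
    rintro _ rfl
    apply SemidirectProduct.ext
    · simp only [SemidirectProduct.mul_left, SemidirectProduct.mul_right,
        SemidirectProduct.left_inl, SemidirectProduct.right_inl, SemidirectProduct.left_inr,
        SemidirectProduct.right_inr, map_one, MulAut.one_apply, mul_one, one_mul, hst]
      exact Subtype.ext (mul_comm (f : B → A) (g.left : B → A))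
    · simp
  · show SemidirectProduct.inl g.left * SemidirectProduct.inr c' *
      SemidirectProduct.inr (c'⁻¹ * g.right) = g
    rw [mul_assoc, ← map_mul, mul_inv_cancel_left, SemidirectProduct.inl_left_mul_inr_right]

/-- If `A` is abelian and residually-`𝒞`, and `B` is infinite `𝒞`-HCS
with all cyclic subgroups `𝒞`-separable, then every element of the base group satisfies
the `𝒞`-centralizer condition in `A ≀ B`. -/
theorem base_elements_CC (V : ECPseudoVariety.{u}) (A B : Type u) [Group A] [Group B]
    (habA : ∀ x y : A, x * y = y * x) (hresA : V.Residually A)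
    [Infinite B] (hB : V.HCS B)
    (hcyc : ∀ x : B, V.CSeparable ((Subgroup.zpowers x : Subgroup B) : Set B))
    (f : WreathBase A B) :
    V.SatisfiesCCAt (SemidirectProduct.inl f : RWreath A B) := by
  letI : CommGroup A := { ‹Group A› with mul_comm := habA }
  exact aux_main V A B hresA hcyc f
end
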